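/- Assume the 1/10-quasi-Riemann hypothesis. Then for every ε ∈ (0, 1/1000) there is a constant C_ε > 0 such that for all X ≥ 2 and all H with X^ε ≤ H ≤ X^{1−ε}, one has (1/X)·∫_X^{2X} | ∑_{x < n ≤ x+H} 1^■(n) − ( (ζ(3/2)/ζ(3))·D_{1/2}(x;H) + (ζ(2/3)/ζ(2))·D_{1/3}(x;H) ) |² dx ≤ C_ε · X^{1/5 + 5ε}. -/

import Mathlib

open MeasureTheory
open scoped Classical

/-- `n` is square-full: every prime dividing `n` divides it at least twice. -/
def IsSquarefull (n : ℕ) : Prop := ∀ p : ℕ, p.Prime → p ∣ n → p ^ 2 ∣ n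

/-- Indicator function of square-full integers. -/
noncomputable def sqf (n : ℕ) : ℝ := if IsSquarefull n then 1 else 0

/-- Real value of the Riemann zeta function at a real point. -/
noncomputable def zr (s : ℝ) : ℝ := (riemannZeta (s : ℂ)).re

/-- `D r x y = (x+y)^r - x^r`. -/
noncomputable def Dd (r x y : ℝ) : ℝ := (x + y) ^ r - x ^ r

/-- The `r`-quasi-Riemann hypothesis: every nontrivial zero `s` of the Riemann zeta
function satisfies `1/2 - r ≤ Re s ≤ 1/2 + r`. -/
def QRH (r : ℝ) : Prop :=
  ∀ s : ℂ, riemannZeta s = 0 → (¬ ∃ n : ℕ, s = -2 * ((n : ℂ) + 1)) →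
    1/2 - r ≤ s.re ∧ s.re ≤ 1/2 + r

open FourierTransform ComplexInnerProductSpace SchwartzMap in
/-- Plancherel's theorem for an integrable, square-integrable function whose Fourier integral is
square-integrable. -/
theorem integral_norm_sq_fourier_eq {f : ℝ → ℂ} (h1 : Integrable f) (h2 : MemLp f 2)
    (h3 : MemLp (𝓕 f) 2) : ∫ ξ, ‖𝓕 f ξ‖ ^ 2 = ∫ u, ‖f u‖ ^ 2 := by
  have key : h3.toLp = 𝓕 h2.toLp := by
    refine (SchwartzMap.denseRange_toLpCLM (E := ℝ) (F := ℂ) (p := 2) (μ := volume)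
      ENNReal.ofNat_ne_top).eq_of_inner_left ℂ ?_
    intro φ
    change ⟪h3.toLp, φ.toLp 2 volume⟫ = ⟪𝓕 h2.toLp, φ.toLp 2 volume⟫
    have e1 : φ.toLp 2 = 𝓕 ((𝓕⁻ φ).toLp 2) := by
      rw [SchwartzMap.toLp_fourier_eq, FourierTransform.fourier_fourierInv_eq]
    have e2 : ⟪h3.toLp, φ.toLp 2⟫ = ∫ ξ, ⟪𝓕 f ξ, φ ξ⟫ := by
      rw [L2.inner_def]
      apply integral_congr_ae
      filter_upwards [h3.coeFn_toLp, φ.coeFn_toLp 2] with x hx hy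
      rw [hx, hy]
    have e3 : ⟪h2.toLp, (𝓕⁻ φ).toLp 2⟫ = ∫ ξ, ⟪f ξ, 𝓕⁻ φ ξ⟫ := by
      rw [L2.inner_def]
      apply integral_congr_ae
      filter_upwards [h2.coeFn_toLp, (𝓕⁻ φ).coeFn_toLp 2] with x hx hy
      rw [hx, hy]
    rw [e2]
    conv_rhs => rw [e1]
    rw [Lp.inner_fourier_eq, e3]
    simpa [fourierInv_coe] using! VectorFourier.integral_sesq_fourierIntegral_eq_neg_flip (innerSL ℂ)
      (L := innerₗ ℝ) Real.continuous_fourierChar continuous_inner h1 φ.integrable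
  have hn := congrArg (fun z => ‖z‖) key
  simp only [Lp.norm_fourier_eq] at hn
  have sq (g : ℝ → ℂ) (hg : MemLp g 2) : ∫ ξ, ‖g ξ‖ ^ 2 = ‖hg.toLp‖ ^ 2 := by
    have := @L2.inner_def ℝ ℂ ℂ _ _ volume _ _ hg.toLp hg.toLp
    rw [inner_self_eq_norm_sq_to_K] at this
    have h' : (∫ a, ⟪(hg.toLp : ℝ → ℂ) a, (hg.toLp : ℝ → ℂ) a⟫) = ((∫ ξ, ‖g ξ‖ ^ 2 : ℝ) : ℂ) := by
      rw [← integral_complex_ofReal]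
      apply integral_congr_ae
      filter_upwards [hg.coeFn_toLp] with x hx
      rw [hx, inner_self_eq_norm_sq_to_K]; simp
    rw [h'] at this
    exact Complex.ofReal_injective (by simpa using this.symm)
  rw [sq _ h3, sq _ h2, hn]

open ProbabilityTheory Filter Topology in
/-- **Landau's lemma** for Laplace transforms of positive measures on the half-line: if the
transform extends holomorphically to a disc centred on the real axis, the integral converges at the
real points of the disc. -/
theorem integrable_exp_of_differentiableOn_ball {μ : Measure ℝ} (hμ : ∀ᵐ u ∂μ, 0 ≤ u)
    {a z₀ z₁ r : ℝ} (hInteg : ∀ x : ℝ, a < x → Integrable (fun u => Real.exp (-(x * u))) μ)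
    {R : ℂ → ℂ} (haz : a < z₀) (hR : DifferentiableOn ℂ R (Metric.ball (z₀ : ℂ) r))
    (heq : ∀ᶠ x : ℝ in 𝓝 z₀, R x = ((∫ u, Real.exp (-(x * u)) ∂μ : ℝ) : ℂ))
    (h1 : z₀ - r < z₁) (h2 : z₁ ≤ z₀) :
    Integrable (fun u => Real.exp (-(z₁ * u))) μ := by
  set X : ℝ → ℝ := fun u => -u with hX
  have hsub : Set.Ioi a ⊆ integrableExpSet X μ := by
    intro x hx
    simpa [integrableExpSet, hX] using hInteg x hx
  have hz₀ : z₀ ∈ interior (integrableExpSet X μ) :=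
    interior_maximal hsub isOpen_Ioi haz
  have hr : 0 < r := by linarith
  have hA : AnalyticAt ℂ (complexMGF X μ) z₀ := analyticAt_complexMGF (by simpa using hz₀)
  have hRA : AnalyticAt ℂ R z₀ :=
    hR.analyticAt (Metric.isOpen_ball.mem_nhds (Metric.mem_ball_self hr))
  have hfreq : ∃ᶠ z in 𝓝[≠] (z₀ : ℂ), R z = complexMGF X μ z := by
    have ht : Tendsto (fun x : ℝ => (x : ℂ)) (𝓝[≠] z₀) (𝓝[≠] (z₀ : ℂ)) := by
      refine tendsto_nhdsWithin_iff.2 ⟨?_, ?_⟩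
      · exact (Complex.continuous_ofReal.tendsto z₀).mono_left nhdsWithin_le_nhds
      · filter_upwards [self_mem_nhdsWithin] with x hx
        simpa using hx
    refine ht.frequently (Eventually.frequently ?_)
    filter_upwards [nhdsWithin_le_nhds heq] with x hx
    rw [hx, complexMGF_ofReal]
    simp [mgf, hX]
  have hev : R =ᶠ[𝓝 (z₀ : ℂ)] complexMGF X μ := (hRA.frequently_eq_iff_eventually_eq hA).1 hfreq
  have hz₁ : (z₁ : ℂ) ∈ Metric.ball (z₀ : ℂ) r := by
    rw [Metric.mem_ball, Complex.dist_eq, ← Complex.ofReal_sub, Complex.norm_real, Real.norm_eq_abs,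
      abs_lt]
    constructor <;> linarith
  have hs := (Complex.hasSum_taylorSeries_on_ball hR hz₁).summable
  set g : ℕ → ℝ → ℝ := fun n u => ((z₀ - z₁) * u) ^ n / n.factorial * Real.exp (-(z₀ * u)) with hg
  have hterm (n : ℕ) : ((n.factorial : ℂ))⁻¹ • ((z₁ : ℂ) - z₀) ^ n • iteratedDeriv n R z₀
      = ((∫ u, g n u ∂μ : ℝ) : ℂ) := by
    rw [hev.iteratedDeriv_eq n, iteratedDeriv_complexMGF (by simpa using hz₀), smul_eq_mul,
      smul_eq_mul, ← integral_const_mul, ← integral_const_mul, ← integral_complex_ofReal]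
    congr 1
    ext u
    simp only [hg, hX]
    push_cast
    rw [show ((z₀ : ℂ) - z₁) * u = ((z₁ : ℂ) - z₀) * (-u) by ring, mul_pow]
    ring_nf
  simp_rw [hterm] at hs
  have hs' : Summable fun n => ∫ u, g n u ∂μ := Complex.summable_ofReal.1 hs
  have hgint (n : ℕ) : Integrable (g n) μ := by
    have := integrable_pow_mul_exp_of_mem_interior_integrableExpSet hz₀ n
    convert this.const_mul ((z₁ - z₀) ^ n / n.factorial) using 1
    ext u
    simp only [hg, hX]
    rw [show (z₀ - z₁) * u = (z₁ - z₀) * (-u) by ring, mul_pow]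
    ring_nf
  have hgnn (n : ℕ) : ∀ᵐ u ∂μ, 0 ≤ g n u := by
    filter_upwards [hμ] with u hu
    simp only [hg]
    have : 0 ≤ z₀ - z₁ := by linarith
    positivity
  refine ⟨by fun_prop, ?_⟩
  rw [hasFiniteIntegral_iff_ofReal (ae_of_all _ fun u => (Real.exp_pos _).le)]
  have hsum : ∀ᵐ u ∂μ, ENNReal.ofReal (Real.exp (-(z₁ * u))) = ∑' n, ENNReal.ofReal (g n u) := by
    filter_upwards [ae_all_iff.2 hgnn] with u hu
    have hexp : HasSum (fun n => g n u) (Real.exp (-(z₁ * u))) := by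
      have := (NormedSpace.expSeries_div_hasSum_exp ((z₀ - z₁) * u)).mul_right
        (Real.exp (-(z₀ * u)))
      rw [← Real.exp_eq_exp_ℝ, ← Real.exp_add] at this
      convert this using 2
      congr 1
      ring
    rw [← hexp.tsum_eq, ENNReal.ofReal_tsum_of_nonneg hu hexp.summable]
  rw [lintegral_congr_ae hsum, lintegral_tsum fun n => by fun_prop]
  simp_rw [← fun n => ofReal_integral_eq_lintegral_ofReal (hgint n) (hgnn n)]
  rw [← ENNReal.ofReal_tsum_of_nonneg (fun n => integral_nonneg_of_ae (hgnn n)) hs']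
  exact ENNReal.ofReal_lt_top

open Filter Topology in
/-- A parametric integral of holomorphic functions with a common integrable bound is holomorphic. -/
theorem differentiableAt_integral_of_dominated_ball {F : ℂ → ℝ → ℂ} {μ : Measure ℝ} {z₀ : ℂ} {r : ℝ}
    (hr : 0 < r) {b : ℝ → ℝ} (hb : Integrable b μ)
    (hm : ∀ z ∈ Metric.ball z₀ r, AEStronglyMeasurable (F z) μ)
    (hd : ∀ ξ, DifferentiableOn ℂ (fun z => F z ξ) (Metric.ball z₀ r))
    (hF : ∀ z ∈ Metric.ball z₀ r, ∀ ξ, ‖F z ξ‖ ≤ b ξ) :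
    DifferentiableAt ℂ (fun z => ∫ ξ, F z ξ ∂μ) z₀ := by
  have hself : z₀ ∈ Metric.ball z₀ r := Metric.mem_ball_self hr
  have hball : Metric.ball z₀ r ∈ 𝓝 z₀ := Metric.ball_mem_nhds z₀ hr
  have hderiv : ∀ ξ, HasDerivAt (fun z => F z ξ) (deriv (fun z => F z ξ) z₀) z₀ := fun ξ =>
    ((hd ξ).differentiableAt hball).hasDerivAt
  refine (hasDerivAt_integral_of_dominated_loc_of_deriv_le (s := Metric.ball z₀ (r / 2))
    (F' := fun z ξ => deriv (fun z => F z ξ) z) (bound := fun ξ => b ξ / (r / 3))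
    (Metric.ball_mem_nhds z₀ (by linarith)) ?_ ?_ ?_ ?_ (hb.div_const _) ?_).2.differentiableAt
  · filter_upwards [hball] with z hz using hm z hz
  · exact hb.mono' (hm z₀ hself) (ae_of_all _ fun ξ => hF z₀ hself ξ)
  · obtain ⟨v, -, hv, hv0⟩ := exists_seq_strictAnti_tendsto' hr
    have hvc : Tendsto (fun n => (v n : ℂ)) atTop (𝓝 0) := by
      exact_mod_cast (Complex.continuous_ofReal.tendsto 0).comp hv0
    refine aestronglyMeasurable_of_tendsto_ae atTop
      (f := fun n ξ => (v n : ℂ)⁻¹ • (F (z₀ + v n) ξ - F z₀ ξ)) ?_ (ae_of_all _ fun ξ => ?_)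
    · intro n
      refine AEStronglyMeasurable.const_smul (AEStronglyMeasurable.sub (hm _ ?_) (hm z₀ hself)) ((v n : ℂ)⁻¹)
      simp only [Metric.mem_ball, dist_self_add_left, Complex.norm_real, Real.norm_eq_abs]
      rw [abs_of_pos (hv n).1]
      exact (hv n).2
    · refine (hderiv ξ).tendsto_slope_zero.comp (tendsto_nhdsWithin_iff.2 ⟨hvc, ?_⟩)
      exact Eventually.of_forall fun n => by simpa using (hv n).1.ne'
  · refine ae_of_all _ fun ξ z hz => ?_
    have hsub : Metric.closedBall z (r / 3) ⊆ Metric.ball z₀ r := by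
      intro w hw
      have h1 := Metric.mem_closedBall.1 hw
      have h2 := Metric.mem_ball.1 hz
      have := dist_triangle w z z₀
      rw [Metric.mem_ball]; linarith
    refine Complex.norm_deriv_le_of_forall_mem_sphere_norm_le (by linarith) ?_ fun w hw =>
      hF w (hsub (Metric.sphere_subset_closedBall hw)) ξ
    exact ((hd ξ).mono hsub).diffContOnCl_ball subset_rfl
  · refine ae_of_all _ fun ξ z hz => ?_
    exact ((hd ξ).differentiableAt (Metric.isOpen_ball.mem_nhds
      (Metric.ball_subset_ball (by linarith) hz))).hasDerivAt

theorem rpow_neg_one_add_abs_le {p x y Y : ℝ} (hp : 0 ≤ p) (hy : |y| ≤ Y) :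
    (1 + |y + x|) ^ (-p) ≤ (1 + Y) ^ p * (1 + |x|) ^ (-p) := by
  have h : 1 + |x| ≤ (1 + Y) * (1 + |y + x|) := by
    have h1 : |x| ≤ |y + x| + |y| := by
      have := abs_sub (y + x) y
      simpa using this
    nlinarith [abs_nonneg (y + x), abs_nonneg y]
  have hY : 0 ≤ Y := (abs_nonneg y).trans hy
  have hx0 : (0:ℝ) < 1 + |x| := by positivity
  have hxy0 : (0:ℝ) < 1 + |y + x| := by positivity
  have hpow := Real.rpow_le_rpow hx0.le h hp
  rw [Real.mul_rpow (by positivity) hxy0.le] at hpow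
  rw [Real.rpow_neg hxy0.le, Real.rpow_neg hx0.le, ← div_eq_mul_inv,
    inv_eq_one_div, div_le_div_iff₀ (by positivity) (by positivity)]
  simpa using hpow

theorem differentiableAt_integral_mul_reflect {G : ℂ → ℂ} {α β p C : ℝ}
    (hG : DifferentiableOn ℂ G {s | α < s.re ∧ s.re < β}) (hp : 1 / 2 < p)
    (hGb : ∀ s : ℂ, α < s.re → s.re < β → ‖G s‖ ≤ C * (1 + |s.im|) ^ (-p))
    {z₀ : ℂ} (h1 : 2 * α < z₀.re) (h2 : z₀.re < 2 * β) :
    DifferentiableAt ℂ (fun z : ℂ => ∫ ξ : ℝ, G (z / 2 + (2 * Real.pi * ξ : ℝ) * Complex.I) *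
      G (z / 2 - (2 * Real.pi * ξ : ℝ) * Complex.I)) z₀ := by
  have hopen : IsOpen {s : ℂ | α < s.re ∧ s.re < β} :=
    (isOpen_lt continuous_const Complex.continuous_re).inter
      (isOpen_lt Complex.continuous_re continuous_const)
  have hopen' : IsOpen {s : ℂ | 2 * α < s.re ∧ s.re < 2 * β} :=
    (isOpen_lt continuous_const Complex.continuous_re).inter
      (isOpen_lt Complex.continuous_re continuous_const)
  obtain ⟨r, hr, hball⟩ := Metric.isOpen_iff.1 hopen' z₀ ⟨h1, h2⟩
  have hmem (z : ℂ) (hz : z ∈ Metric.ball z₀ r) (x : ℝ) :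
      (z / 2 + x * Complex.I) ∈ {s : ℂ | α < s.re ∧ s.re < β} := by
    obtain ⟨h, h'⟩ := hball hz
    have e : (z / 2 + x * Complex.I).re = z.re / 2 := by simp
    refine ⟨?_, ?_⟩ <;> rw [e] <;> linarith
  have hmem' (z : ℂ) (hz : z ∈ Metric.ball z₀ r) (x : ℝ) :
      (z / 2 - x * Complex.I) ∈ {s : ℂ | α < s.re ∧ s.re < β} := by
    simpa [sub_eq_add_neg] using hmem z hz (-x)
  have hC : 0 ≤ C := by
    have h := hmem z₀ (Metric.mem_ball_self hr) 0
    have := (norm_nonneg _).trans (hGb _ h.1 h.2)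
    exact nonneg_of_mul_nonneg_left this (by positivity)
  set Y : ℝ := (|z₀.im| + r) / 2 with hY
  have hbd (z : ℂ) (hz : z ∈ Metric.ball z₀ r) (x : ℝ) :
      ‖G (z / 2 + x * Complex.I)‖ ≤ C * ((1 + Y) ^ p * (1 + |x|) ^ (-p)) := by
    refine (hGb _ (hmem z hz x).1 (hmem z hz x).2).trans ?_
    have e : (z / 2 + x * Complex.I).im = z.im / 2 + x := by simp
    rw [e]
    refine mul_le_mul_of_nonneg_left (rpow_neg_one_add_abs_le (by linarith) ?_) hC
    have h3 : |(z - z₀).im| ≤ ‖z - z₀‖ := Complex.abs_im_le_norm _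
    rw [Metric.mem_ball, Complex.dist_eq] at hz
    rw [Complex.sub_im] at h3
    have h4 := abs_add_le (z.im - z₀.im) z₀.im
    rw [sub_add_cancel] at h4
    rw [abs_div, abs_two, hY]
    linarith
  have hbd' (z : ℂ) (hz : z ∈ Metric.ball z₀ r) (x : ℝ) :
      ‖G (z / 2 - x * Complex.I)‖ ≤ C * ((1 + Y) ^ p * (1 + |x|) ^ (-p)) := by
    simpa [sub_eq_add_neg] using hbd z hz (-x)
  have hY0 : 0 ≤ Y := by positivity
  refine differentiableAt_integral_of_dominated_ball hr
    (b := fun ξ => (C * (1 + Y) ^ p) ^ 2 * (1 + ‖ξ‖) ^ (-(2 * p))) ?_ ?_ ?_ ?_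
  · refine (integrable_one_add_norm ?_).const_mul _
    simp; linarith
  · intro z hz
    have hc : Continuous fun ξ : ℝ => z / 2 + (2 * Real.pi * ξ : ℝ) * Complex.I := by fun_prop
    have hc' : Continuous fun ξ : ℝ => z / 2 - (2 * Real.pi * ξ : ℝ) * Complex.I := by fun_prop
    exact ((hG.continuousOn.comp_continuous hc fun ξ => hmem z hz _).mul
      (hG.continuousOn.comp_continuous hc' fun ξ => hmem' z hz _)).aestronglyMeasurable
  · intro ξ
    refine DifferentiableOn.mul (hG.comp (by fun_prop) fun z hz => hmem z hz _)
      (hG.comp (by fun_prop) fun z hz => hmem' z hz _)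
  · intro z hz ξ
    rw [norm_mul]
    have h5 : (1 + |2 * Real.pi * ξ|) ^ (-p) ≤ (1 + ‖ξ‖) ^ (-p) := by
      refine Real.rpow_le_rpow_of_nonpos (by positivity) ?_ (by linarith)
      rw [abs_mul, abs_of_pos (by positivity), Real.norm_eq_abs]
      nlinarith [Real.pi_gt_three, abs_nonneg ξ]
    have h6 : C * ((1 + Y) ^ p * (1 + |2 * Real.pi * ξ|) ^ (-p)) ≤
        C * (1 + Y) ^ p * (1 + ‖ξ‖) ^ (-p) := by
      rw [← mul_assoc]; exact mul_le_mul_of_nonneg_left h5 (by positivity)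
    calc _ ≤ (C * (1 + Y) ^ p * (1 + ‖ξ‖) ^ (-p)) * (C * (1 + Y) ^ p * (1 + ‖ξ‖) ^ (-p)) :=
          mul_le_mul ((hbd z hz _).trans h6) ((hbd' z hz _).trans h6) (norm_nonneg _) (by positivity)
      _ = (C * (1 + Y) ^ p) ^ 2 * ((1 + ‖ξ‖) ^ (-p) * (1 + ‖ξ‖) ^ (-p)) := by ring
      _ = _ := by
          rw [← Real.rpow_add (by positivity)]; ring_nf

theorem integrable_mul_exp_of_le {g : ℝ → ℝ} (hg : Measurable g) (hg0 : ∀ u < 0, g u = 0)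
    {A a b : ℝ} (hA : ∀ u, 0 ≤ u → |g u| ≤ A * Real.exp (a * u)) (hab : a < b) :
    Integrable fun u => g u * Real.exp (-(b * u)) := by
  have hi : IntegrableOn (fun u => A * Real.exp ((a - b) * u)) (Set.Ioi 0) :=
    (integrableOn_exp_mul_Ioi (by linarith) 0).const_mul A
  have hi' := integrableOn_Ici_iff_integrableOn_Ioi (by simp) |>.2 hi
  rw [← integrable_indicator_iff measurableSet_Ici] at hi'
  refine hi'.mono' (by fun_prop) (ae_of_all _ fun u => ?_)
  rcases lt_or_ge u 0 with hu | hu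
  · simp [hg0 u hu, Set.indicator, hu.not_ge]
  · rw [Set.indicator_of_mem (by exact hu), norm_mul, Real.norm_eq_abs, Real.norm_eq_abs,
      abs_of_pos (Real.exp_pos _)]
    calc _ ≤ A * Real.exp (a * u) * Real.exp (-(b * u)) :=
          mul_le_mul_of_nonneg_right (hA u hu) (Real.exp_pos _).le
      _ = _ := by rw [mul_assoc, ← Real.exp_add]; ring_nf

open FourierTransform in
/-- Plancherel's theorem for Laplace transforms on a vertical line of absolute convergence. -/
theorem integral_laplace_mul_reflect {f : ℝ → ℝ} (hf : Measurable f) (hf0 : ∀ u < 0, f u = 0)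
    {A a : ℝ} (hfA : ∀ u, 0 ≤ u → |f u| ≤ A * Real.exp (a * u))
    {G : ℂ → ℂ} {α β p C : ℝ}
    (hG : DifferentiableOn ℂ G {s | α < s.re ∧ s.re < β}) (hp : 1 / 2 < p)
    (hGb : ∀ s : ℂ, α < s.re → s.re < β → ‖G s‖ ≤ C * (1 + |s.im|) ^ (-p))
    (hL : ∀ s : ℂ, a < s.re → s.re < β → G s = ∫ u : ℝ, (f u : ℂ) * Complex.exp (-(s * u)))
    (hαa : α < a) {z : ℝ} (hz : 2 * a < z) (hz' : z < 2 * β) :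
    (∫ ξ : ℝ, G ((z:ℂ) / 2 + (2 * Real.pi * ξ : ℝ) * Complex.I) *
      G ((z:ℂ) / 2 - (2 * Real.pi * ξ : ℝ) * Complex.I)) =
      ((∫ u, f u ^ 2 * Real.exp (-(z * u)) : ℝ) : ℂ) := by
  set φ : ℝ → ℂ := fun u => ((f u * Real.exp (-(z / 2 * u)) : ℝ) : ℂ) with hφ
  have hre (x : ℝ) : ((z:ℂ) / 2 + x * Complex.I).re = z / 2 := by
    simp
  have him (x : ℝ) : ((z:ℂ) / 2 + x * Complex.I).im = x := by
    simp
  have hconj (s : ℂ) (h1 : a < s.re) (h2 : s.re < β) :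
      G (starRingEnd ℂ s) = starRingEnd ℂ (G s) := by
    rw [hL s h1 h2, hL _ (by simpa using h1) (by simpa using h2), ← integral_conj]
    congr 1; ext u
    simp [← Complex.exp_conj]
  have hF (ξ : ℝ) : 𝓕 φ ξ = G ((z:ℂ) / 2 + (2 * Real.pi * ξ : ℝ) * Complex.I) := by
    rw [hL _ (by rw [hre]; linarith) (by rw [hre]; linarith), Real.fourier_eq']
    congr 1; ext u
    rw [hφ]
    simp only [RCLike.inner_apply, conj_trivial, smul_eq_mul]
    push_cast
    rw [mul_left_comm, ← Complex.exp_add]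
    congr 2
    ring
  have hint2 : Integrable fun u => f u ^ 2 * Real.exp (-(z * u)) := by
    refine integrable_mul_exp_of_le (A := A ^ 2) (a := 2 * a) (by fun_prop)
      (fun u hu => by simp [hf0 u hu]) (fun u hu => ?_) hz
    rw [abs_pow]
    calc |f u| ^ 2 ≤ (A * Real.exp (a * u)) ^ 2 := pow_le_pow_left₀ (abs_nonneg _) (hfA u hu) 2
      _ = _ := by rw [mul_pow, ← Real.exp_nat_mul]; push_cast; ring_nf
  have hnorm (u : ℝ) : ‖φ u‖ ^ 2 = f u ^ 2 * Real.exp (-(z * u)) := by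
    rw [hφ, Complex.norm_real, Real.norm_eq_abs, sq_abs, mul_pow, ← Real.exp_nat_mul]
    push_cast; ring_nf
  have hφm : Measurable φ := by fun_prop
  have hφ1 : Integrable φ :=
    (integrable_mul_exp_of_le hf hf0 hfA (by linarith : a < z / 2)).ofReal
  have hφ2 : MemLp φ 2 := by
    rw [memLp_two_iff_integrable_sq_norm hφm.aestronglyMeasurable]
    simpa only [hnorm] using hint2
  have hC : 0 ≤ C := by
    have h := (norm_nonneg _).trans (hGb ((z:ℂ) / 2 + (0:ℝ) * Complex.I)
      (by rw [hre]; linarith) (by rw [hre]; linarith))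
    exact nonneg_of_mul_nonneg_left h (by positivity)
  have hφ3 : MemLp (𝓕 φ) 2 := by
    have hcont : Continuous (𝓕 φ) := by
      rw [show 𝓕 φ = fun ξ : ℝ => G ((z:ℂ) / 2 + (2 * Real.pi * ξ : ℝ) * Complex.I) from
        funext hF]
      refine hG.continuousOn.comp_continuous (by fun_prop) fun ξ => ?_
      exact ⟨by rw [hre]; linarith, by rw [hre]; linarith⟩
    rw [memLp_two_iff_integrable_sq_norm hcont.aestronglyMeasurable]
    have hi : Integrable fun ξ : ℝ => C ^ 2 * (1 + ‖ξ‖) ^ (-(2 * p)) := by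
      refine (integrable_one_add_norm ?_).const_mul _
      simp; linarith
    refine hi.mono' (by fun_prop) (ae_of_all _ fun ξ => ?_)
    have hb := hGb ((z:ℂ) / 2 + (2 * Real.pi * ξ : ℝ) * Complex.I)
      (by rw [hre]; linarith) (by rw [hre]; linarith)
    rw [him] at hb
    have h5 : (1 + |2 * Real.pi * ξ|) ^ (-p) ≤ (1 + ‖ξ‖) ^ (-p) := by
      refine Real.rpow_le_rpow_of_nonpos (by positivity) ?_ (by linarith)
      rw [abs_mul, abs_of_pos (by positivity), Real.norm_eq_abs]
      nlinarith [Real.pi_gt_three, abs_nonneg ξ]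
    have hb' := hb.trans (mul_le_mul_of_nonneg_left h5 hC)
    rw [norm_pow, norm_norm, hF]
    refine (pow_le_pow_left₀ (norm_nonneg _) hb' 2).trans (le_of_eq ?_)
    rw [mul_pow, ← Real.rpow_natCast ((1 + ‖ξ‖) ^ (-p)), ← Real.rpow_mul (by positivity)]
    push_cast; ring_nf
  have hP := integral_norm_sq_fourier_eq hφ1 hφ2 hφ3
  simp only [hnorm] at hP
  rw [← hP, ← integral_complex_ofReal]
  congr 1; ext ξ
  rw [hF]
  have : (z:ℂ) / 2 - (2 * Real.pi * ξ : ℝ) * Complex.I =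
      starRingEnd ℂ ((z:ℂ) / 2 + (2 * Real.pi * ξ : ℝ) * Complex.I) := by
    have : ((z:ℂ) / 2) = ((z / 2 : ℝ) : ℂ) := by push_cast; ring
    rw [this, map_add, map_mul, Complex.conj_ofReal, Complex.conj_ofReal, Complex.conj_I]; ring
  rw [this, hconj _ (by rw [hre]; linarith) (by rw [hre]; linarith), Complex.mul_conj,
    Complex.normSq_eq_norm_sq]

open Filter Topology in
/-- If the Laplace transform of `f` extends to a wider strip with decay faster than
`|Im s|^(-1/2)`, then `f` is square-integrable against the corresponding exponential weights. -/
theorem integrable_sq_mul_exp_of_laplace {f : ℝ → ℝ} (hf : Measurable f) (hf0 : ∀ u < 0, f u = 0)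
    {A a : ℝ} (hfA : ∀ u, 0 ≤ u → |f u| ≤ A * Real.exp (a * u))
    {G : ℂ → ℂ} {α β p C : ℝ}
    (hG : DifferentiableOn ℂ G {s | α < s.re ∧ s.re < β}) (hp : 1 / 2 < p)
    (hGb : ∀ s : ℂ, α < s.re → s.re < β → ‖G s‖ ≤ C * (1 + |s.im|) ^ (-p))
    (hL : ∀ s : ℂ, a < s.re → s.re < β → G s = ∫ u : ℝ, (f u : ℂ) * Complex.exp (-(s * u)))
    (hαa : α < a) (hβ : 2 * a - α < β) {σ : ℝ} (hσ : α < σ) (hσa : σ ≤ a) :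
    Integrable fun u => f u ^ 2 * Real.exp (-(2 * σ * u)) := by
  set μ : Measure ℝ := volume.withDensity fun u => ENNReal.ofReal (f u ^ 2) with hμ
  have hfm : Measurable fun u => (f u ^ 2).toNNReal := by fun_prop
  have hInteg (g : ℝ → ℝ) : Integrable g μ ↔ Integrable fun u => f u ^ 2 * g u := by
    have := integrable_withDensity_iff_integrable_smul (μ := volume) hfm (g := g)
    simp only [NNReal.smul_def, Real.coe_toNNReal _ (sq_nonneg _), smul_eq_mul] at this
    exact this
  have hintegral (g : ℝ → ℝ) : ∫ u, g u ∂μ = ∫ u, f u ^ 2 * g u := by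
    have := integral_withDensity_eq_integral_smul (μ := volume) hfm g
    simp only [NNReal.smul_def, Real.coe_toNNReal _ (sq_nonneg _), smul_eq_mul] at this
    exact this
  have hμ0 : ∀ᵐ u ∂μ, 0 ≤ u := by
    rw [hμ, ae_withDensity_iff (by fun_prop)]
    refine ae_of_all _ fun u hu => ?_
    by_contra! h
    simp [hf0 u h] at hu
  rw [← hInteg]
  set z₀ : ℝ := (2 * a + α + β) / 2 with hz₀
  refine integrable_exp_of_differentiableOn_ball hμ0 (a := 2 * a) (z₀ := z₀) (z₁ := 2 * σ)
    (r := z₀ - 2 * α) (R := fun z : ℂ => ∫ ξ : ℝ, G (z / 2 + (2 * Real.pi * ξ : ℝ) * Complex.I) *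
      G (z / 2 - (2 * Real.pi * ξ : ℝ) * Complex.I)) ?_ (by rw [hz₀]; linarith) ?_ ?_
      (by linarith) (by rw [hz₀]; linarith)
  · intro x hx
    rw [hInteg]
    refine integrable_mul_exp_of_le (A := A ^ 2) (a := 2 * a) (by fun_prop)
      (fun u hu => by simp [hf0 u hu]) (fun u hu => ?_) hx
    rw [abs_pow]
    calc |f u| ^ 2 ≤ (A * Real.exp (a * u)) ^ 2 := pow_le_pow_left₀ (abs_nonneg _) (hfA u hu) 2
      _ = _ := by rw [mul_pow, ← Real.exp_nat_mul]; push_cast; ring_nf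
  · intro z hz
    rw [Metric.mem_ball, Complex.dist_eq] at hz
    have h1 := (Complex.abs_re_le_norm (z - z₀)).trans_lt hz
    rw [Complex.sub_re, Complex.ofReal_re, abs_lt] at h1
    exact (differentiableAt_integral_mul_reflect hG hp hGb (by linarith)
      (by linarith)).differentiableWithinAt
  · have hmem : Set.Ioo (2 * a) (2 * β) ∈ 𝓝 z₀ :=
      Ioo_mem_nhds (by rw [hz₀]; linarith) (by rw [hz₀]; linarith)
    filter_upwards [hmem] with x hx
    rw [hintegral]
    exact integral_laplace_mul_reflect hf hf0 hfA hG hp hGb hL hαa hx.1 hx.2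

open Filter Topology Asymptotics in
theorem riemannZeta₁_eq_integral_fract {s : ℂ} (hs : 0 < s.re) :
    riemannZeta₁ s = s - s * (s - 1) *
      ∫ t : ℝ in Set.Ioi 1, ((Int.fract t : ℝ) : ℂ) * (t : ℂ) ^ (-s - 1) := by
  set f : ℝ → ℂ := (Set.Ioi (1:ℝ)).indicator fun t => ((Int.fract t : ℝ) : ℂ) with hf
  have hfm : Measurable f := Measurable.indicator (by fun_prop) measurableSet_Ioi
  have hf1 (t : ℝ) : ‖f t‖ ≤ 1 := by
    simp only [hf, Set.indicator]
    split_ifs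
    · rw [Complex.norm_real, Real.norm_eq_abs, abs_of_nonneg (Int.fract_nonneg t)]
      exact (Int.fract_lt_one t).le
    · simp
  have hmel (w : ℂ) : mellin f (-w) =
      ∫ t : ℝ in Set.Ioi 1, ((Int.fract t : ℝ) : ℂ) * (t : ℂ) ^ (-w - 1) := by
    rw [mellin, ← integral_indicator measurableSet_Ioi, ← integral_indicator measurableSet_Ioi]
    congr 1; ext t
    by_cases ht : 1 < t
    · simp [hf, Set.indicator, ht, zero_lt_one.trans ht, mul_comm]
    · simp [hf, Set.indicator, ht]
  have hdiff (w : ℂ) (hw : 0 < w.re) : DifferentiableAt ℂ (fun w => mellin f (-w)) w := by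
    have hm : DifferentiableAt ℂ (mellin f) (-w) := by
      refine mellin_differentiableAt_of_isBigO_rpow (a := 0) (b := (-w).re - 1) ?_ ?_
        (by simpa using hw) ?_ (by linarith)
      · have hloc : LocallyIntegrable f := by
          refine (locallyIntegrable_const (1:ℝ)).mono hfm.aestronglyMeasurable
            (ae_of_all _ fun t => by simpa using hf1 t)
        exact hloc.locallyIntegrableOn _
      · refine IsBigO.of_bound 1 (Eventually.of_forall fun t => ?_)
        simpa using hf1 t
      · refine IsBigO.of_bound 1 ?_
        filter_upwards [nhdsWithin_le_nhds (Iio_mem_nhds (zero_lt_one' ℝ))] with t ht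
        have : f t = 0 := by simp [hf, (Set.mem_Iio.1 ht).le]
        rw [this]; simp
    exact hm.comp w differentiableAt_id.neg
  have hopen : IsOpen {w : ℂ | 0 < w.re} := isOpen_lt continuous_const Complex.continuous_re
  have key : Set.EqOn riemannZeta₁ (fun w => w - w * (w - 1) * mellin f (-w)) {w : ℂ | 0 < w.re} := by
    refine AnalyticOnNhd.eqOn_of_preconnected_of_eventuallyEq (z₀ := 2)
      (differentiable_riemannZeta₁.differentiableOn.analyticOnNhd hopen) ?_
      (convex_halfSpace_re_gt 0).isPreconnected (by simp) ?_
    · refine DifferentiableOn.analyticOnNhd (fun w hw => ?_) hopen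
      have := hdiff w hw
      exact (DifferentiableAt.sub (by fun_prop) (DifferentiableAt.mul (by fun_prop)
        this)).differentiableWithinAt
    · have hopen1 : IsOpen {w : ℂ | 1 < w.re} := isOpen_lt continuous_const Complex.continuous_re
      filter_upwards [hopen1.mem_nhds (show (2:ℂ) ∈ {w : ℂ | 1 < w.re} by simp)] with w hw
      have hw1 : w ≠ 1 := by rintro rfl; simp at hw
      have hw0 : w ≠ 0 := by rintro rfl; exact absurd (show (1:ℝ) < (0:ℂ).re from hw) (by norm_num)
      have hZ : riemannZeta₁ w = (w - 1) * riemannZeta w := by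
        rw [riemannZeta_eq_inv_sub_mul hw1, mul_inv_cancel_left₀ (sub_ne_zero.2 hw1)]
      have h1 := LSeries_eq_mul_integral_of_nonneg (fun _ => 1) (r := 1) zero_le_one hw
        (by simpa using isBigO_refl _ _) (fun _ => zero_le_one)
      have h2 : LSeries (fun n => ((fun _ : ℕ => (1:ℝ)) n : ℂ)) w = riemannZeta w := by
        rw [← LSeries_one_eq_riemannZeta hw]; simp [Pi.one_def]
      rw [h2] at h1
      have hint1 : IntegrableOn (fun t : ℝ => (t : ℂ) ^ (-w)) (Set.Ioi 1) :=
        integrableOn_Ioi_cpow_of_lt (by simpa using hw) one_pos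
      have hint2 : IntegrableOn (fun t : ℝ => ((Int.fract t : ℝ) : ℂ) * (t : ℂ) ^ (-w - 1))
          (Set.Ioi 1) := by
        have hi : IntegrableOn (fun t : ℝ => (t : ℂ) ^ (-w - 1)) (Set.Ioi 1) :=
          integrableOn_Ioi_cpow_of_lt (by simp; linarith [Set.mem_ofPred.1 hw]) one_pos
        refine Integrable.bdd_mul (c := 1) hi (by fun_prop) (ae_of_all _ fun t => ?_)
        rw [Complex.norm_real, Real.norm_eq_abs, abs_of_nonneg (Int.fract_nonneg t)]
        exact (Int.fract_lt_one t).le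
      have h3 : ∫ t : ℝ in Set.Ioi 1, (∑ k ∈ Finset.Icc 1 ⌊t⌋₊, (((fun _ : ℕ => (1:ℝ)) k : ℝ) : ℂ)) *
          (t:ℂ) ^ (-(w + 1)) = ∫ t : ℝ in Set.Ioi 1, ((t : ℂ) ^ (-w) -
            ((Int.fract t : ℝ) : ℂ) * (t : ℂ) ^ (-w - 1)) := by
        refine setIntegral_congr_fun measurableSet_Ioi fun t ht => ?_
        have ht0 : (0:ℝ) < t := zero_lt_one.trans ht
        have e1 : (t:ℂ) ^ (-w) = t * (t:ℂ) ^ (-w - 1) := by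
          rw [Complex.cpow_sub _ _ (by exact_mod_cast ht0.ne'), Complex.cpow_one,
            mul_div_cancel₀ _ (by exact_mod_cast ht0.ne')]
        have e2 : ((⌊t⌋₊ : ℝ)) = t - Int.fract t := by
          rw [natCast_floor_eq_intCast_floor ht0.le]
          linarith [Int.floor_add_fract t]
        have e3 : ((⌊t⌋₊ : ℂ)) = t - (Int.fract t : ℝ) := by exact_mod_cast e2
        simp only [Complex.ofReal_one, Finset.sum_const, Nat.card_Icc, add_tsub_cancel_right,
          nsmul_eq_mul, mul_one]
        rw [e1, e3, neg_add']; ring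
      rw [h3, integral_sub hint1 hint2, ← hmel, integral_Ioi_cpow_of_lt (by simpa using hw) one_pos]
        at h1
      have hw2 : -w + 1 ≠ 0 := by
        intro h; exact hw1 (by linear_combination -h)
      rw [hZ, h1, Complex.ofReal_one, Complex.one_cpow]
      field_simp
      ring
  rw [← hmel]
  exact key hs

theorem norm_riemannZeta₁_le {s : ℂ} (hs : 0 < s.re) :
    ‖riemannZeta₁ s‖ ≤ ‖s‖ + ‖s‖ * (‖s‖ + 1) * (1 / s.re) := by
  rw [riemannZeta₁_eq_integral_fract hs]
  refine (norm_sub_le _ _).trans ?_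
  rw [norm_mul, norm_mul]
  have h1 : ‖s - 1‖ ≤ ‖s‖ + 1 := (norm_sub_le _ _).trans (by simp)
  have h2 : ‖∫ t : ℝ in Set.Ioi 1, ((Int.fract t : ℝ) : ℂ) * (t : ℂ) ^ (-s - 1)‖ ≤ 1 / s.re := by
    have h3 : ∫ t : ℝ in Set.Ioi 1, t ^ (-s.re - 1) = 1 / s.re := by
      rw [integral_Ioi_rpow_of_lt (by linarith) one_pos]
      simp [div_neg, neg_div]
    rw [← h3]
    refine norm_integral_le_of_norm_le (integrableOn_Ioi_rpow_of_lt (by linarith) one_pos) ?_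
    refine (ae_restrict_iff' measurableSet_Ioi).2 (ae_of_all _ fun t ht => ?_)
    rw [norm_mul, Complex.norm_cpow_eq_rpow_re_of_pos (zero_lt_one.trans ht), Complex.norm_real,
      Real.norm_eq_abs, abs_of_nonneg (Int.fract_nonneg t)]
    have : 0 ≤ t ^ (-s - 1).re := Real.rpow_nonneg (zero_lt_one.trans ht).le _
    calc _ ≤ 1 * t ^ (-s - 1).re := mul_le_mul_of_nonneg_right (Int.fract_lt_one t).le this
      _ = _ := by simp
  gcongr

/-- The factor in the functional equation `ζ (1 - w) = zetaFactor w * ζ w`. -/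
noncomputable def zetaFactor (w : ℂ) : ℂ :=
  2 * (2 * Real.pi) ^ (-w) * Complex.Gamma w * Complex.cos (Real.pi * w / 2)

theorem zetaFactor_mul_one_sub {w : ℂ} (hw : Complex.sin (Real.pi * w) ≠ 0) :
    zetaFactor w * zetaFactor (1 - w) = 1 := by
  have h2π : (2 * Real.pi : ℂ) ≠ 0 := by exact_mod_cast Real.two_pi_pos.ne'
  have hΓ := Complex.Gamma_mul_Gamma_one_sub w
  have hs : Complex.sin (Real.pi * w) =
      2 * Complex.sin (Real.pi * w / 2) * Complex.cos (Real.pi * w / 2) := by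
    rw [← Complex.sin_two_mul]; ring_nf
  have hc : Complex.cos (Real.pi * (1 - w) / 2) = Complex.sin (Real.pi * w / 2) := by
    rw [← Complex.cos_pi_div_two_sub]; ring_nf
  have hp : (2 * Real.pi : ℂ) ^ (-w) * (2 * Real.pi : ℂ) ^ (-(1 - w)) = (2 * Real.pi : ℂ)⁻¹ := by
    rw [← Complex.cpow_add _ _ h2π, ← Complex.cpow_neg_one]; ring_nf
  calc zetaFactor w * zetaFactor (1 - w) = 4 * ((2 * Real.pi : ℂ) ^ (-w) *
      (2 * Real.pi : ℂ) ^ (-(1 - w))) * (Complex.Gamma w * Complex.Gamma (1 - w)) *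
      (Complex.cos (Real.pi * w / 2) * Complex.cos (Real.pi * (1 - w) / 2)) := by
        rw [zetaFactor, zetaFactor]; ring
    _ = 1 := by
        have hπ : (Real.pi : ℂ) ≠ 0 := by exact_mod_cast Real.pi_pos.ne'
        rw [hp, hΓ, hc]
        field_simp
        rw [hs]; ring

open ComplexConjugate in
theorem zetaFactor_conj (w : ℂ) : zetaFactor (conj w) = conj (zetaFactor w) := by
  have h1 : (2 * Real.pi : ℂ) ^ (-conj w) = conj ((2 * Real.pi : ℂ) ^ (-w)) := by
    have h : (2 * Real.pi : ℂ) = ((2 * Real.pi : ℝ) : ℂ) := by push_cast; ring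
    rw [h, ← map_neg, Complex.cpow_conj, Complex.conj_ofReal]
    rw [Complex.arg_ofReal_of_nonneg Real.two_pi_pos.le]
    exact Real.pi_pos.ne
  have h2 : Complex.cos (Real.pi * conj w / 2) = conj (Complex.cos (Real.pi * w / 2)) := by
    rw [← Complex.cos_conj]; simp [map_ofNat (starRingEnd ℂ) 2]
  rw [zetaFactor, zetaFactor, h1, h2, Complex.Gamma_conj]
  simp [map_ofNat (starRingEnd ℂ) 2]

theorem norm_zetaFactor_of_re_eq_half {w : ℂ} (hw : w.re = 1 / 2) : ‖zetaFactor w‖ = 1 := by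
  have h1 : 1 - w = starRingEnd ℂ w := by
    apply Complex.ext <;> simp [hw]; norm_num
  have hs : Complex.sin (Real.pi * w) ≠ 0 := by
    rw [Ne, Complex.sin_eq_zero_iff]
    rintro ⟨k, hk⟩
    have hπ : (Real.pi : ℂ) ≠ 0 := by exact_mod_cast Real.pi_pos.ne'
    have hk' : w = k := by
      apply mul_left_cancel₀ hπ; rw [hk]; ring
    have := congrArg Complex.re hk'
    rw [hw, Complex.intCast_re] at this
    have h : (1:ℝ) = 2 * k := by linarith
    have h' : (1:ℤ) = 2 * k := by exact_mod_cast h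
    omega
  have h := zetaFactor_mul_one_sub hs
  rw [h1, zetaFactor_conj, Complex.mul_conj, Complex.normSq_eq_norm_sq] at h
  have h' : ‖zetaFactor w‖ ^ 2 = 1 := by exact_mod_cast h
  exact (pow_eq_one_iff_of_nonneg (norm_nonneg _) two_ne_zero).1 h'

theorem norm_zetaFactor_of_re_eq_three_half {w : ℂ} (hw : w.re = 3 / 2) :
    ‖zetaFactor w‖ ≤ ‖w - 1‖ := by
  have h2π : (2 * Real.pi : ℂ) ≠ 0 := by exact_mod_cast Real.two_pi_pos.ne'
  set v : ℂ := w - 1 with hv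
  have hvre : v.re = 1 / 2 := by rw [hv]; simp [hw]; norm_num
  have hv0 : v ≠ 0 := by
    intro h; rw [h] at hvre; norm_num at hvre
  have hwv : w = v + 1 := by rw [hv]; ring
  have hsc : ‖Complex.cos (Real.pi * w / 2)‖ = ‖Complex.cos (Real.pi * v / 2)‖ := by
    have h1 : Complex.cos (Real.pi * w / 2) = - Complex.sin (Real.pi * v / 2) := by
      rw [hwv, mul_add, add_div, mul_one, Complex.cos_add_pi_div_two]
    have h2 : Complex.sin (Real.pi * v / 2) =
        starRingEnd ℂ (Complex.cos (Real.pi * v / 2)) := by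
      rw [← Complex.cos_pi_div_two_sub, ← Complex.cos_conj]
      congr 1
      have h3 : starRingEnd ℂ v = 1 - v := by
        apply Complex.ext <;> simp [hvre]; norm_num
      simp [h3, map_ofNat (starRingEnd ℂ) 2]; ring
    rw [h1, norm_neg, h2, RCLike.norm_conj]
  have hpow : (2 * Real.pi : ℂ) ^ (-w) = (2 * Real.pi : ℂ) ^ (-v) * (2 * Real.pi : ℂ)⁻¹ := by
    rw [← Complex.cpow_neg_one, ← Complex.cpow_add _ _ h2π, hwv]; ring_nf
  have hΓ : Complex.Gamma w = v * Complex.Gamma v := by rw [hwv, Complex.Gamma_add_one v hv0]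
  have h1 := norm_zetaFactor_of_re_eq_half hvre
  rw [zetaFactor, norm_mul, norm_mul, norm_mul] at h1
  have hπ1 : ‖(2 * Real.pi : ℂ)⁻¹‖ ≤ 1 := by
    rw [norm_inv]
    have : ‖(2 * Real.pi : ℂ)‖ = 2 * Real.pi := by
      simp [abs_of_pos Real.pi_pos]
    rw [this]
    exact inv_le_one_of_one_le₀ (by nlinarith [Real.pi_gt_three])
  rw [zetaFactor, norm_mul, norm_mul, norm_mul, hsc, hpow, hΓ, norm_mul, norm_mul]
  calc _ = (‖(2:ℂ)‖ * ‖(2 * Real.pi : ℂ) ^ (-v)‖ * ‖Complex.Gamma v‖ *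
        ‖Complex.cos (Real.pi * v / 2)‖) * ‖(2 * Real.pi : ℂ)⁻¹‖ * ‖v‖ := by ring
    _ = ‖(2 * Real.pi : ℂ)⁻¹‖ * ‖v‖ := by rw [h1, one_mul]
    _ ≤ 1 * ‖v‖ := by gcongr
    _ = _ := one_mul _

theorem Complex.norm_Gamma_le {w : ℂ} (hw : 0 < w.re) : ‖Complex.Gamma w‖ ≤ Real.Gamma w.re := by
  rw [Complex.Gamma_eq_integral hw, Real.Gamma_eq_integral hw, Complex.GammaIntegral]
  refine norm_integral_le_of_norm_le (Real.GammaIntegral_convergent hw) ?_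
  refine (ae_restrict_iff' measurableSet_Ioi).2 (ae_of_all _ fun t ht => ?_)
  rw [norm_mul, Complex.norm_cpow_eq_rpow_re_of_pos ht, Complex.norm_real, Real.norm_eq_abs,
    abs_of_pos (Real.exp_pos _)]
  simp

theorem Complex.norm_cos_le (z : ℂ) : ‖Complex.cos z‖ ≤ Real.exp |z.im| := by
  have h1 : ‖Complex.exp (z * Complex.I)‖ ≤ Real.exp |z.im| := by
    rw [Complex.norm_exp]
    exact Real.exp_le_exp.2 (by simpa using neg_le_abs z.im)
  have h2 : ‖Complex.exp (-z * Complex.I)‖ ≤ Real.exp |z.im| := by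
    rw [Complex.norm_exp]
    exact Real.exp_le_exp.2 (by simpa using le_abs_self z.im)
  rw [Complex.cos, norm_div, Complex.norm_ofNat, div_le_iff₀ two_pos]
  exact (norm_add_le _ _).trans (by linarith)

theorem exists_norm_zetaFactor_le_exp : ∃ K : ℝ, 0 ≤ K ∧ ∀ w : ℂ, 1 / 2 ≤ w.re → w.re ≤ 3 / 2 →
    ‖zetaFactor w‖ ≤ K * Real.exp (2 * |w.im|) := by
  have hcont : ContinuousOn Real.Gamma (Set.Icc (1/2) (3/2)) := by
    intro x hx
    refine (Real.differentiableAt_Gamma fun m => ?_).continuousAt.continuousWithinAt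
    have : (0:ℝ) ≤ m := m.cast_nonneg
    have := hx.1
    linarith
  obtain ⟨M, hM⟩ := (isCompact_Icc.image_of_continuousOn hcont).bddAbove
  have hM' (x : ℝ) (h1 : 1/2 ≤ x) (h2 : x ≤ 3/2) : Real.Gamma x ≤ M :=
    hM ⟨x, ⟨h1, h2⟩, rfl⟩
  have hM0 : 0 ≤ M := (Real.Gamma_pos_of_pos (by norm_num)).le.trans (hM' 1 (by norm_num) (by norm_num))
  refine ⟨2 * M, by positivity, fun w h1 h2 => ?_⟩
  have e1 : ‖(2 * Real.pi : ℂ) ^ (-w)‖ ≤ 1 := by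
    have h : (2 * Real.pi : ℂ) = ((2 * Real.pi : ℝ) : ℂ) := by push_cast; ring
    rw [h, Complex.norm_cpow_eq_rpow_re_of_pos Real.two_pi_pos]
    exact Real.rpow_le_one_of_one_le_of_nonpos (by nlinarith [Real.pi_gt_three])
      (by simp; linarith)
  have e2 : ‖Complex.Gamma w‖ ≤ M := (Complex.norm_Gamma_le (by linarith)).trans (hM' _ h1 h2)
  have e3 : ‖Complex.cos (Real.pi * w / 2)‖ ≤ Real.exp (2 * |w.im|) := by
    refine (Complex.norm_cos_le _).trans (Real.exp_le_exp.2 ?_)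
    have : (Real.pi * w / 2 : ℂ).im = Real.pi / 2 * w.im := by simp; ring
    rw [this, abs_mul, abs_of_pos (by positivity)]
    have := Real.pi_lt_four
    gcongr; linarith
  rw [zetaFactor, norm_mul, norm_mul, norm_mul, Complex.norm_ofNat]
  calc _ ≤ 2 * 1 * M * Real.exp (2 * |w.im|) := by gcongr
    _ = _ := by ring

theorem differentiableAt_zetaFactor {w : ℂ} (hw : 0 < w.re) :
    DifferentiableAt ℂ zetaFactor w := by
  have h2π : (2 * Real.pi : ℂ) ≠ 0 := by exact_mod_cast Real.two_pi_pos.ne'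
  have hΓ : DifferentiableAt ℂ Complex.Gamma w := by
    refine Complex.differentiableAt_Gamma _ fun m h => ?_
    rw [h] at hw
    have : (0:ℝ) ≤ m := m.cast_nonneg
    simp at hw; linarith
  unfold zetaFactor
  have h1 : DifferentiableAt ℂ (fun w : ℂ => (2 * Real.pi : ℂ) ^ (-w)) w :=
    (differentiableAt_id.neg).const_cpow (Or.inl h2π)
  exact ((h1.const_mul 2).mul hΓ).mul (by fun_prop)

open Complex.HadamardThreeLines in
theorem norm_zetaFactor_le {w₀ : ℂ} (h1 : 1 / 2 ≤ w₀.re) (h2 : w₀.re ≤ 3 / 2) :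
    ‖zetaFactor w₀‖ ≤ Real.exp 3 * (1 + |w₀.im|) ^ (w₀.re - 1 / 2) := by
  obtain ⟨K, hK, hKb⟩ := exists_norm_zetaFactor_le_exp
  set f : ℂ → ℂ := fun w => zetaFactor w * Complex.exp ((w - w₀) ^ 2) with hf
  have hexp (w : ℂ) (h3 : 1 / 2 ≤ w.re) (h4 : w.re ≤ 3 / 2) :
      ‖Complex.exp ((w - w₀) ^ 2)‖ ≤ Real.exp (1 - |w.im - w₀.im| ^ 2) := by
    rw [Complex.norm_exp]
    refine Real.exp_le_exp.2 ?_
    have : ((w - w₀) ^ 2).re = (w.re - w₀.re) ^ 2 - (w.im - w₀.im) ^ 2 := by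
      rw [pow_two]; simp; ring
    rw [this, sq_abs]
    nlinarith
  have htri (w : ℂ) : |w.im| ≤ |w₀.im| + |w.im - w₀.im| := by
    have := abs_add_le w₀.im (w.im - w₀.im)
    simpa using this
  have hz : w₀ ∈ verticalClosedStrip (1 / 2) (3 / 2) := ⟨h1, h2⟩
  have hd : DiffContOnCl ℂ f (verticalStrip (1 / 2) (3 / 2)) := by
    refine DifferentiableOn.diffContOnCl fun w hw => ?_
    have hw' : 0 < w.re := by
      have hsub : closure (verticalStrip (1 / 2) (3 / 2)) ⊆ {w : ℂ | 1 / 2 ≤ w.re} :=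
        closure_minimal (fun x hx => hx.1.le) (isClosed_le continuous_const Complex.continuous_re)
      have : 1 / 2 ≤ w.re := hsub hw
      linarith
    exact ((differentiableAt_zetaFactor hw').mul (by fun_prop)).differentiableWithinAt
  have hB : BddAbove ((norm ∘ f) '' verticalClosedStrip (1 / 2) (3 / 2)) := by
    refine ⟨K * Real.exp (2 + 2 * |w₀.im|), ?_⟩
    rintro _ ⟨w, hw, rfl⟩
    simp only [Function.comp, hf, norm_mul]
    calc _ ≤ (K * Real.exp (2 * |w.im|)) * Real.exp (1 - |w.im - w₀.im| ^ 2) :=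
          mul_le_mul (hKb w hw.1 hw.2) (hexp w hw.1 hw.2) (norm_nonneg _) (by positivity)
      _ = K * Real.exp (2 * |w.im| + (1 - |w.im - w₀.im| ^ 2)) := by
          rw [Real.exp_add]; ring
      _ ≤ _ := by
          refine mul_le_mul_of_nonneg_left (Real.exp_le_exp.2 ?_) hK
          nlinarith [htri w, sq_nonneg (|w.im - w₀.im| - 1)]
  have ha : ∀ z ∈ Complex.re ⁻¹' {(1 / 2 : ℝ)}, ‖f z‖ ≤ Real.exp 3 := by
    intro w hw
    have hw' : w.re = 1 / 2 := hw
    rw [hf, norm_mul, norm_zetaFactor_of_re_eq_half hw', one_mul]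
    refine (hexp w (by linarith) (by linarith)).trans (Real.exp_le_exp.2 ?_)
    nlinarith [sq_nonneg (|w.im - w₀.im|)]
  have hb : ∀ z ∈ Complex.re ⁻¹' {(3 / 2 : ℝ)}, ‖f z‖ ≤ Real.exp 3 * (1 + |w₀.im|) := by
    intro w hw
    have hw' : w.re = 3 / 2 := hw
    rw [hf, norm_mul]
    have h5 : ‖w - 1‖ ≤ (1 + |w₀.im|) * Real.exp (|w.im - w₀.im|) := by
      refine (Complex.norm_le_abs_re_add_abs_im _).trans ?_
      simp only [Complex.sub_re, Complex.sub_im, Complex.one_re, Complex.one_im, hw', sub_zero]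
      have h6 := Real.add_one_le_exp (|w.im - w₀.im|)
      have h7 : |(3 / 2 - 1 : ℝ)| ≤ 1 := by norm_num [abs_le]
      nlinarith [htri w, abs_nonneg (w.im - w₀.im), abs_nonneg w₀.im]
    calc _ ≤ ((1 + |w₀.im|) * Real.exp (|w.im - w₀.im|)) * Real.exp (1 - |w.im - w₀.im| ^ 2) :=
          mul_le_mul ((norm_zetaFactor_of_re_eq_three_half hw').trans h5)
            (hexp w (by linarith) (by linarith)) (norm_nonneg _) (by positivity)
      _ = Real.exp (|w.im - w₀.im| + (1 - |w.im - w₀.im| ^ 2)) * (1 + |w₀.im|) := by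
          rw [Real.exp_add]; ring
      _ ≤ _ := by
          gcongr
          nlinarith [sq_nonneg (|w.im - w₀.im| - 1 / 2)]
  have key := norm_le_interp_of_mem_verticalClosedStrip' (by norm_num) hz hd hB ha hb
  have hfw : f w₀ = zetaFactor w₀ := by simp [hf]
  rw [hfw] at key
  refine key.trans (le_of_eq ?_)
  rw [Real.mul_rpow (Real.exp_pos _).le (by positivity), ← mul_assoc,
    ← Real.rpow_add (Real.exp_pos _)]
  norm_num

/-- **Hadamard's three circles theorem**, for a closed disc. -/
theorem Complex.norm_le_of_three_circles {f : ℂ → ℂ} {r₁ r₂ R a b : ℝ} (h1 : 0 < r₁) (h12 : r₁ < r₂)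
    (h2 : r₂ < R) (hf : DifferentiableOn ℂ f (Metric.ball 0 R))
    (ha : ∀ z, ‖z‖ = r₁ → ‖f z‖ ≤ a) (hb : ∀ z, ‖z‖ = r₂ → ‖f z‖ ≤ b) {z : ℂ}
    (hz1 : r₁ ≤ ‖z‖) (hz2 : ‖z‖ ≤ r₂) :
    ‖f z‖ ≤ a ^ (1 - (Real.log ‖z‖ - Real.log r₁) / (Real.log r₂ - Real.log r₁)) *
      b ^ ((Real.log ‖z‖ - Real.log r₁) / (Real.log r₂ - Real.log r₁)) := by
  have hz0 : 0 < ‖z‖ := h1.trans_le hz1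
  have hz : z ≠ 0 := norm_pos_iff.1 hz0
  have hsub : Metric.closedBall (0:ℂ) r₂ ⊆ Metric.ball 0 R := Metric.closedBall_subset_ball h2
  have hmem (w : ℂ) (hw : w.re ≤ Real.log r₂) : Complex.exp w ∈ Metric.closedBall (0:ℂ) r₂ := by
    rw [mem_closedBall_zero_iff, Complex.norm_exp, ← Real.le_log_iff_exp_le (h1.trans h12)]
    exact hw
  have key := Complex.HadamardThreeLines.norm_le_interp_of_mem_verticalClosedStrip'
    (f := fun w => f (Complex.exp w)) (z := Complex.log z) (a := a) (b := b)
    (Real.log_lt_log h1 h12) ?_ ?_ ?_ ?_ ?_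
  · simpa only [Complex.exp_log hz, Complex.log_re] using key
  · simp only [Complex.HadamardThreeLines.verticalClosedStrip, Set.mem_preimage, Complex.log_re]
    exact ⟨Real.log_le_log h1 hz1, Real.log_le_log hz0 hz2⟩
  · refine DifferentiableOn.diffContOnCl fun w hw => ?_
    have hw' : w.re ≤ Real.log r₂ :=
      closure_minimal (fun (x : ℂ) (hx : x ∈ Complex.re ⁻¹' Set.Ioo _ _) => hx.2.le)
        (isClosed_le Complex.continuous_re continuous_const) hw
    have h3 := (hf.differentiableAt (Metric.isOpen_ball.mem_nhds (hsub (hmem w hw'))))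
    exact (h3.comp w Complex.differentiable_exp.differentiableAt).differentiableWithinAt
  · have hcont : ContinuousOn (fun z => ‖f z‖) (Metric.closedBall (0:ℂ) r₂) :=
      (hf.continuousOn.mono hsub).norm
    obtain ⟨M, hM⟩ := ((isCompact_closedBall (0:ℂ) r₂).image_of_continuousOn hcont).bddAbove
    refine ⟨M, ?_⟩
    rintro _ ⟨w, hw, rfl⟩
    exact hM ⟨_, hmem w hw.2, rfl⟩
  · intro w hw
    have hw' : w.re = Real.log r₁ := hw
    exact ha _ (by rw [Complex.norm_exp, hw', Real.exp_log h1])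
  · intro w hw
    have hw' : w.re = Real.log r₂ := hw
    exact hb _ (by rw [Complex.norm_exp, hw', Real.exp_log (h1.trans h12)])

theorem exists_rpow_le_mul_add {θ δ : ℝ} (h0 : 0 ≤ θ) (h1 : θ < 1) (hδ : 0 < δ) :
    ∃ C, 0 ≤ C ∧ ∀ x : ℝ, 0 ≤ x → x ^ θ ≤ δ * x + C := by
  set Y : ℝ := δ ^ (-(1 / (1 - θ))) with hY
  have hY0 : 0 < Y := Real.rpow_pos_of_pos hδ _
  refine ⟨Y ^ θ, by positivity, fun x hx => ?_⟩
  rcases le_or_gt x Y with h | h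
  · have := Real.rpow_le_rpow hx h h0
    nlinarith [mul_nonneg hδ.le hx]
  · have hx0 : 0 < x := hY0.trans h
    have h2 : x ^ (θ - 1) ≤ Y ^ (θ - 1) := Real.rpow_le_rpow_of_nonpos hY0 h.le (by linarith)
    have h3 : Y ^ (θ - 1) = δ := by
      rw [hY, ← Real.rpow_mul hδ.le]
      have : -(1 / (1 - θ)) * (θ - 1) = 1 := by
        have : 1 - θ ≠ 0 := by linarith
        field_simp; ring
      rw [this, Real.rpow_one]
    have h4 : x ^ θ = x ^ (θ - 1) * x := by
      rw [Real.rpow_sub_one hx0.ne', div_mul_cancel₀ _ hx0.ne']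
    rw [h4]
    have : 0 < Y ^ θ := by positivity
    rw [h3] at h2
    nlinarith

/-- A nonvanishing holomorphic function on a disc has a holomorphic logarithm. -/
theorem exists_log_on_ball {φ : ℂ → ℂ} {R : ℝ} (hR : 0 < R)
    (hφ : DifferentiableOn ℂ φ (Metric.ball 0 R)) (hφ0 : ∀ z ∈ Metric.ball 0 R, φ z ≠ 0)
    (h1 : φ 0 = 1) : ∃ f : ℂ → ℂ, DifferentiableOn ℂ f (Metric.ball 0 R) ∧ f 0 = 0 ∧
      ∀ z ∈ Metric.ball 0 R, φ z = Complex.exp (f z) := by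
  have hd : DifferentiableOn ℂ (fun z => deriv φ z / φ z) (Metric.ball 0 R) :=
    (hφ.deriv Metric.isOpen_ball).div hφ hφ0
  obtain ⟨g, hg⟩ := hd.isExactOn_ball
  have hmem : (0:ℂ) ∈ Metric.ball (0:ℂ) R := Metric.mem_ball_self hR
  refine ⟨fun z => g z - g 0, fun z hz => ?_, by simp, fun z hz => ?_⟩
  · exact ((hg z hz).differentiableAt.sub_const _).differentiableWithinAt
  · have hF (w : ℂ) (hw : w ∈ Metric.ball (0:ℂ) R) :
        HasDerivAt (fun w => φ w * Complex.exp (-(g w - g 0))) 0 w := by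
      have h2 := (hφ.differentiableAt (Metric.isOpen_ball.mem_nhds hw)).hasDerivAt
      have h3 := h2.mul ((hg w hw).sub_const (g 0)).neg.cexp
      refine h3.congr_deriv ?_
      have h4 : φ w * (deriv φ w / φ w) = deriv φ w := mul_div_cancel₀ _ (hφ0 w hw)
      change deriv φ w * Complex.exp (-(g w - g 0)) +
        φ w * (Complex.exp (-(g w - g 0)) * -(deriv φ w / φ w)) = 0
      linear_combination -Complex.exp (-(g w - g 0)) * h4
    have hc := Metric.isOpen_ball.is_const_of_deriv_eq_zero
      (convex_ball (0:ℂ) R).isPreconnected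
      (fun w hw => (hF w hw).differentiableAt.differentiableWithinAt)
      (fun w hw => (hF w hw).deriv) hz hmem
    simp only [sub_self, neg_zero, Complex.exp_zero, mul_one, h1] at hc
    rw [Complex.exp_neg, mul_inv_eq_one₀ (Complex.exp_ne_zero _)] at hc
    exact hc

/-- A nonvanishing holomorphic function on a disc which is bounded on a smaller disc and at most
`exp M` on the whole disc is within a factor `exp (δ M + O(1))` of `1` on intermediate discs. -/
theorem exists_norm_le_exp_of_ne_zero {r₀ ρ R B δ : ℝ} (h0 : 0 < r₀) (h0ρ : r₀ ≤ ρ) (hρR : ρ < R)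
    (hB : 0 < B) (hδ : 0 < δ) :
    ∃ C : ℝ, ∀ (φ : ℂ → ℂ) (M : ℝ), 0 < M → DifferentiableOn ℂ φ (Metric.ball 0 R) →
      (∀ z ∈ Metric.ball 0 R, φ z ≠ 0) → φ 0 = 1 →
      (∀ z ∈ Metric.ball 0 r₀, ‖φ z‖ ≤ Real.exp B) →
      (∀ z ∈ Metric.ball 0 R, ‖φ z‖ ≤ Real.exp M) →
      ∀ z, ‖z‖ ≤ ρ → ‖φ z‖ ≤ Real.exp (δ * M + C) ∧ ‖(φ z)⁻¹‖ ≤ Real.exp (δ * M + C) := by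
  set r₁ : ℝ := r₀ / 2 with hr₁
  set r₂ : ℝ := (ρ + R) / 2 with hr₂
  have hr₁0 : 0 < r₁ := by positivity
  have h12 : r₁ < r₂ := by rw [hr₁, hr₂]; linarith
  have h2R : r₂ < R := by rw [hr₂]; linarith
  set a : ℝ := 2 * B * r₁ / (r₀ - r₁) with ha
  have hr01 : 0 < r₀ - r₁ := by rw [hr₁]; linarith
  have ha0 : 0 < a := by positivity
  set k : ℝ := 2 * r₂ / (R - r₂) with hk
  have hk0 : 0 < k := div_pos (by linarith) (by linarith)
  set θ : ℝ := (Real.log ρ - Real.log r₁) / (Real.log r₂ - Real.log r₁) with hθ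
  have hl1ρ : Real.log r₁ < Real.log ρ := Real.log_lt_log hr₁0 (by rw [hr₁]; linarith)
  have hlρ2 : Real.log ρ < Real.log r₂ := Real.log_lt_log (by linarith) (by rw [hr₂]; linarith)
  have hl : 0 < Real.log r₂ - Real.log r₁ := by linarith
  have hθ0 : 0 ≤ θ := div_nonneg (by linarith) hl.le
  have hθ1 : θ < 1 := by rw [hθ, div_lt_one hl]; linarith
  obtain ⟨C, hC0, hC⟩ := exists_rpow_le_mul_add hθ0 hθ1 (div_pos hδ hk0)
  refine ⟨a * (δ / k) + a * C + a, fun φ M hM hφ hφ0 hφ1 hφB hφM z hz => ?_⟩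
  obtain ⟨f, hf, hf0, hfφ⟩ := exists_log_on_ball (by linarith) hφ hφ0 hφ1
  have hre (z : ℂ) (hz : z ∈ Metric.ball (0:ℂ) R) : ‖φ z‖ = Real.exp (f z).re := by
    rw [hfφ z hz, Complex.norm_exp]
  have hsmall (w : ℂ) (hw : ‖w‖ ≤ r₁) : ‖f w‖ ≤ a := by
    have hsub : Metric.ball (0:ℂ) r₀ ⊆ Metric.ball 0 R := Metric.ball_subset_ball (by linarith)
    have hw0 : ‖w‖ < r₀ := by rw [hr₁] at hw; linarith
    refine (Complex.borelCaratheodory_zero hB (hf.mono hsub) (fun v hv => ?_) h0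
      (mem_ball_zero_iff.2 hw0) hf0).trans ?_
    · have := hφB v hv
      rw [hre v (hsub hv), Real.exp_le_exp] at this
      exact this
    · rw [ha]; gcongr
  have hlarge (w : ℂ) (hw : ‖w‖ ≤ r₂) : ‖f w‖ ≤ k * M := by
    refine (Complex.borelCaratheodory_zero hM hf (fun v hv => ?_) (by linarith)
      (mem_ball_zero_iff.2 (by linarith)) hf0).trans ?_
    · have := hφM v hv
      rw [hre v hv, Real.exp_le_exp] at this
      exact this
    · have : k * M = 2 * M * r₂ / (R - r₂) := by rw [hk]; ring
      rw [this]
      have : 0 < R - r₂ := by linarith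
      have : 0 ≤ r₂ := by linarith
      gcongr
  have hmain : ‖f z‖ ≤ δ * M + (a * (δ / k) + a * C + a) := by
    rcases le_or_gt ‖z‖ r₁ with hz1 | hz1
    · have := hsmall z hz1
      have h3 : 0 ≤ a * (δ / k) := by positivity
      have h4 : 0 ≤ a * C := by positivity
      nlinarith [mul_pos hδ hM]
    · have key := Complex.norm_le_of_three_circles hr₁0 h12 h2R hf (a := a) (b := a * (1 + k * M / a))
        (fun w hw => hsmall w hw.le) (fun w hw => (hlarge w hw.le).trans (by
          have : a * (1 + k * M / a) = a + k * M := by field_simp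
          rw [this]; linarith)) hz1.le (by rw [hr₂]; linarith)
      set η := (Real.log ‖z‖ - Real.log r₁) / (Real.log r₂ - Real.log r₁) with hη
      have hηθ : η ≤ θ := by
        rw [hη, hθ]
        have := Real.log_le_log (hr₁0.trans hz1) hz
        gcongr
      have hx0 : 0 ≤ k * M / a := by positivity
      have e : a ^ (1 - η) * (a * (1 + k * M / a)) ^ η = a * (1 + k * M / a) ^ η := by
        rw [Real.mul_rpow ha0.le (by positivity), ← mul_assoc, ← Real.rpow_add ha0,
          sub_add_cancel, Real.rpow_one]
      rw [e] at key
      have h5 : (1 + k * M / a) ^ η ≤ (1 + k * M / a) ^ θ :=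
        Real.rpow_le_rpow_of_exponent_le (by linarith) hηθ
      have h6 := hC (1 + k * M / a) (by linarith)
      have h7 : a * (1 + k * M / a) ^ η ≤ a * (δ / k * (1 + k * M / a) + C) :=
        mul_le_mul_of_nonneg_left (h5.trans h6) ha0.le
      have h8 : a * (δ / k * (1 + k * M / a) + C) = a * (δ / k) + δ * M + a * C := by
        field_simp
      linarith
  have hzR : z ∈ Metric.ball (0:ℂ) R := mem_ball_zero_iff.2 (by linarith)
  refine ⟨?_, ?_⟩
  · rw [hre z hzR, Real.exp_le_exp]
    exact (Complex.re_le_norm _).trans hmain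
  · rw [norm_inv, hre z hzR, ← Real.exp_neg, Real.exp_le_exp]
    exact (neg_le_abs _).trans ((Complex.abs_re_le_norm _).trans hmain)

theorem exists_norm_LSeries_le {f : ℕ → ℂ} {a : ℝ} (h : LSeriesSummable f a) :
    ∃ K : ℝ, ∀ s : ℂ, a ≤ s.re → ‖LSeries f s‖ ≤ K := by
  refine ⟨∑' n, ‖LSeries.term f a n‖, fun s hs => ?_⟩
  have h1 : ∀ n, ‖LSeries.term f s n‖ ≤ ‖LSeries.term f a n‖ := fun n =>
    LSeries.norm_term_le_of_re_le_re f (by simpa using hs) n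
  have h2 : Summable fun n => ‖LSeries.term f s n‖ :=
    h.norm.of_nonneg_of_le (fun _ => norm_nonneg _) h1
  exact (norm_tsum_le_tsum_norm h2).trans (h2.tsum_le_tsum h1 h.norm)

theorem exists_norm_riemannZeta_le :
    ∃ K : ℝ, 2 ≤ K ∧ ∀ s : ℂ, 5 / 4 ≤ s.re → ‖riemannZeta s‖ ≤ K ∧ ‖(riemannZeta s)⁻¹‖ ≤ K := by
  obtain ⟨K₁, h1⟩ := exists_norm_LSeries_le (f := 1) (a := 5 / 4)
    (LSeriesSummable_one_iff.2 (by norm_num))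
  obtain ⟨K₂, h2⟩ := exists_norm_LSeries_le (f := fun n => (ArithmeticFunction.moebius n : ℂ))
    (a := 5 / 4) (ArithmeticFunction.LSeriesSummable_moebius_iff.2 (by norm_num))
  refine ⟨max 2 (max K₁ K₂), le_max_left _ _, fun s hs => ?_⟩
  have hs1 : 1 < s.re := by linarith
  have h3 := LSeries_one_mul_Lseries_moebius hs1
  have h4 := LSeries_one_eq_riemannZeta hs1
  constructor
  · rw [← h4]
    exact (h1 s hs).trans ((le_max_left _ _).trans (le_max_right _ _))
  · rw [← h4, inv_eq_of_mul_eq_one_right h3]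
    exact (h2 s hs).trans ((le_max_right _ _).trans (le_max_right _ _))

theorem QRH.riemannZeta_ne_zero {r : ℝ} (hr : 0 ≤ r) (h : QRH r) {s : ℂ} (hs : 1 / 2 + r < s.re) :
    riemannZeta s ≠ 0 := by
  intro h0
  refine absurd (h s h0 ?_).2 (by linarith)
  rintro ⟨n, rfl⟩
  have : (-2 * ((n : ℂ) + 1)).re = -2 * (n + 1) := by simp
  rw [this] at hs
  have : (0 : ℝ) ≤ n := n.cast_nonneg
  linarith

theorem QRH.riemannZeta₁_ne_zero {r : ℝ} (hr : 0 ≤ r) (h : QRH r) {s : ℂ}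
    (hs : 1 / 2 + r < s.re) : riemannZeta₁ s ≠ 0 := by
  rcases eq_or_ne s 1 with rfl | h1
  · simp [riemannZeta₁_one]
  · intro h0
    apply h.riemannZeta_ne_zero hr hs
    rw [riemannZeta_eq_inv_sub_mul h1, h0, mul_zero]

theorem QRH.exists_norm_riemannZeta_le_rpow (h : QRH (1 / 10)) {δ δ' : ℝ} (hδ : 0 < δ)
    (hδ' : 0 < δ') (hδ'1 : δ' ≤ 1 / 2) :
    ∃ C : ℝ, ∀ w : ℂ, 3 / 5 + δ' ≤ w.re → w.re ≤ 2 → 2 ≤ |w.im| →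
      ‖riemannZeta w‖ ≤ C * |w.im| ^ δ ∧ ‖(riemannZeta w)⁻¹‖ ≤ C * |w.im| ^ δ := by
  obtain ⟨K, hK2, hK⟩ := exists_norm_riemannZeta_le
  have hK0 : 0 < K := by linarith
  obtain ⟨C, hC⟩ := exists_norm_le_exp_of_ne_zero (r₀ := 3 / 4) (ρ := 7 / 5 - δ') (R := 7 / 5)
    (B := Real.log (K * K)) (δ := δ / 2) (by norm_num) (by linarith) (by linarith)
    (Real.log_pos (by nlinarith)) (by linarith)
  refine ⟨K * (Real.exp C * (45 * K) ^ (δ / 2)), fun w hw1 hw2 hw3 => ?_⟩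
  set T := |w.im| with hT
  have hT0 : 0 < T := by linarith
  set c : ℂ := ⟨2, w.im⟩ with hc
  have hcre : c.re = 2 := rfl
  have hcim : c.im = w.im := rfl
  obtain ⟨hc1, hc2⟩ := hK c (by rw [hcre]; norm_num)
  have hcne : riemannZeta c ≠ 0 := riemannZeta_ne_zero_of_one_lt_re (by rw [hcre]; norm_num)
  have hre : ∀ z ∈ Metric.ball (0 : ℂ) (7 / 5), 3 / 5 < (c + z).re := fun z hz => by
    rw [mem_ball_zero_iff] at hz
    have := (abs_le.1 (Complex.abs_re_le_norm z)).1
    rw [Complex.add_re, hcre]; linarith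
  have him : ∀ z ∈ Metric.ball (0 : ℂ) (7 / 5), 3 / 5 ≤ |(c + z).im| := fun z hz => by
    rw [mem_ball_zero_iff] at hz
    have h1 := (Complex.abs_im_le_norm z)
    have h2 : |w.im| ≤ |(c + z).im| + |z.im| := by
      rw [Complex.add_im, hcim]
      calc |w.im| = |w.im + z.im - z.im| := by ring_nf
        _ ≤ _ := abs_sub _ _
    linarith
  have hne1 : ∀ z ∈ Metric.ball (0 : ℂ) (7 / 5), c + z ≠ 1 := fun z hz h1 => by
    have := him z hz
    rw [h1] at this
    norm_num at this
  have hbig : ∀ z ∈ Metric.ball (0 : ℂ) (7 / 5),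
      ‖riemannZeta (c + z) / riemannZeta c‖ ≤ 45 * K * T ^ 2 := fun z hz => by
    have h1 := hre z hz
    have h2 := him z hz
    have h3 := norm_riemannZeta₁_le (s := c + z) (by linarith)
    have hz' := mem_ball_zero_iff.1 hz
    have h4 : ‖c + z‖ ≤ 3 * T := by
      have h5 := Complex.norm_le_abs_re_add_abs_im c
      rw [hcre, hcim, abs_of_pos (by norm_num : (0 : ℝ) < 2)] at h5
      linarith [norm_add_le c z]
    have h5 : 1 / (c + z).re ≤ 5 / 3 := by
      rw [div_le_div_iff₀ (by linarith) (by norm_num)]; linarith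
    have h6 : ‖riemannZeta₁ (c + z)‖ ≤ 27 * T ^ 2 := by
      have h7 : ‖c + z‖ * (‖c + z‖ + 1) * (1 / (c + z).re) ≤ (3 * T) * (3 * T + 1) * (5 / 3) := by
        gcongr
      nlinarith
    have h7 : 3 / 5 ≤ ‖c + z - 1‖ := by
      have := Complex.abs_im_le_norm (c + z - 1)
      rw [Complex.sub_im, Complex.one_im, sub_zero] at this
      linarith
    have h8 : ‖(c + z - 1)⁻¹‖ ≤ 5 / 3 := by
      rw [norm_inv]
      calc _ ≤ (3 / 5 : ℝ)⁻¹ := inv_anti₀ (by norm_num) h7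
        _ = _ := by norm_num
    rw [riemannZeta_eq_inv_sub_mul (hne1 z hz), div_eq_mul_inv, norm_mul, norm_mul]
    calc _ ≤ 5 / 3 * (27 * T ^ 2) * K := by gcongr
      _ = _ := by ring
  have hM : 0 < Real.log (45 * K * T ^ 2) := Real.log_pos (by nlinarith)
  have hKT : 0 < 45 * K * T ^ 2 := by positivity
  have key := hC (fun z => riemannZeta (c + z) / riemannZeta c) (Real.log (45 * K * T ^ 2)) hM
    (fun z hz => ((differentiableAt_riemannZeta (hne1 z hz)).comp z
      (differentiableAt_id.const_add c) |>.div_const _).differentiableWithinAt)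
    (fun z hz => div_ne_zero (h.riemannZeta_ne_zero (by norm_num)
      (by linarith [hre z hz])) hcne)
    (by simp [div_self hcne])
    (fun z hz => by
      rw [Real.exp_log (by positivity), div_eq_mul_inv, norm_mul]
      have : 5 / 4 ≤ (c + z).re := by
        rw [mem_ball_zero_iff] at hz
        have := (abs_le.1 (Complex.abs_re_le_norm z)).1
        rw [Complex.add_re, hcre]; linarith
      have := (hK _ this).1
      gcongr)
    (fun z hz => by rw [Real.exp_log hKT]; exact hbig z hz)
    (w - c) (by
      have h1 : w - c = ((w.re - 2 : ℝ) : ℂ) := by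
        apply Complex.ext <;> simp [hc]
      rw [h1, Complex.norm_real, Real.norm_eq_abs, abs_le]
      constructor <;> linarith)
  simp only [add_sub_cancel] at key
  have hexp : Real.exp (δ / 2 * Real.log (45 * K * T ^ 2) + C) =
      Real.exp C * (45 * K) ^ (δ / 2) * T ^ δ := by
    rw [Real.exp_add, mul_comm (δ / 2), ← Real.rpow_def_of_pos hKT,
      Real.mul_rpow (by positivity) (by positivity), ← Real.rpow_natCast T 2, ← Real.rpow_mul hT0.le]
    rw [show ((2 : ℕ) : ℝ) * (δ / 2) = δ by push_cast; ring]
    ring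
  rw [hexp] at key
  obtain ⟨k1, k2⟩ := key
  rw [inv_div, norm_div] at k2
  rw [norm_div] at k1
  have hcpos : 0 < ‖riemannZeta c‖ := norm_pos_iff.2 hcne
  set Q := Real.exp C * (45 * K) ^ (δ / 2) * T ^ δ with hQ
  have hQ0 : 0 ≤ Q := by positivity
  have e1 : K * (Real.exp C * (45 * K) ^ (δ / 2)) * T ^ δ = Q * K := by rw [hQ]; ring
  rw [e1]
  constructor
  · rw [div_le_iff₀ hcpos] at k1
    exact k1.trans (by gcongr)
  · rw [norm_inv]
    have h9 : ‖riemannZeta w‖⁻¹ = ‖riemannZeta c‖ / ‖riemannZeta w‖ * ‖(riemannZeta c)⁻¹‖ := by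
      rw [norm_inv]; field_simp
    rw [h9]
    gcongr

theorem QRH.exists_norm_riemannZeta₁_le_rpow (h : QRH (1 / 10)) {δ δ' : ℝ} (hδ : 0 < δ)
    (hδ' : 0 < δ') (hδ'1 : δ' ≤ 1 / 2) :
    ∃ C : ℝ, 0 < C ∧ ∀ w : ℂ, 3 / 5 + δ' ≤ w.re →
      ‖riemannZeta₁ w‖ ≤ C * (1 + ‖w‖) ^ (1 + δ) ∧
      ‖(riemannZeta₁ w)⁻¹‖ ≤ C * (1 + ‖w‖) ^ (-1 + δ) := by
  obtain ⟨K, hK2, hK⟩ := exists_norm_riemannZeta_le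
  obtain ⟨C₁, hC₁⟩ := h.exists_norm_riemannZeta_le_rpow hδ hδ' hδ'1
  have hcpt : IsCompact (Set.Icc (3 / 5 + δ') (5 / 4) ×ℂ Set.Icc (-2) 2) :=
    isCompact_Icc.reProdIm isCompact_Icc
  obtain ⟨C₂, hC₂⟩ := hcpt.exists_bound_of_continuousOn
    differentiable_riemannZeta₁.continuous.continuousOn
  obtain ⟨C₃, hC₃⟩ := hcpt.exists_bound_of_continuousOn (f := fun w => (riemannZeta₁ w)⁻¹)
    (differentiable_riemannZeta₁.continuous.continuousOn.inv₀ fun w hw =>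
      h.riemannZeta₁_ne_zero (by norm_num) (by linarith [hw.1.1]))
  set C := max K (max C₁ (max C₂ C₃)) with hC
  have hCK : K ≤ C := le_max_left _ _
  have hCC₁ : C₁ ≤ C := (le_max_left _ _).trans (le_max_right _ _)
  have hCC₂ : C₂ ≤ C := (le_max_left _ _).trans ((le_max_right _ _).trans (le_max_right _ _))
  have hCC₃ : C₃ ≤ C := (le_max_right _ _).trans ((le_max_right _ _).trans (le_max_right _ _))
  have hC0 : 0 < C := by linarith
  refine ⟨9 * C, by positivity, fun w hw => ?_⟩
  have hw0 : 0 < 1 + ‖w‖ := by positivity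
  have hw1 : 1 ≤ 1 + ‖w‖ := by linarith [norm_nonneg w]
  have hmain : (1 + ‖w‖) / 9 ≤ ‖w - 1‖ → ‖riemannZeta w‖ ≤ C * (1 + ‖w‖) ^ δ →
      ‖(riemannZeta w)⁻¹‖ ≤ C * (1 + ‖w‖) ^ δ → ‖riemannZeta₁ w‖ ≤ 9 * C * (1 + ‖w‖) ^ (1 + δ) ∧
      ‖(riemannZeta₁ w)⁻¹‖ ≤ 9 * C * (1 + ‖w‖) ^ (-1 + δ) := by
    intro h1 h2 h3
    have h4 : 0 < ‖w - 1‖ := lt_of_lt_of_le (by positivity) h1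
    have hne : w ≠ 1 := by rintro rfl; simp at h4
    have h5 : riemannZeta₁ w = (w - 1) * riemannZeta w := by
      rw [riemannZeta_eq_inv_sub_mul hne, mul_inv_cancel_left₀ (sub_ne_zero.2 hne)]
    have h6 : ‖w - 1‖ ≤ 1 + ‖w‖ := by
      have := norm_sub_le w 1
      rw [norm_one] at this; linarith
    rw [h5, mul_inv, norm_mul, norm_mul, Real.rpow_add hw0, Real.rpow_add hw0, Real.rpow_one,
      Real.rpow_neg_one, norm_inv]
    constructor
    · calc ‖w - 1‖ * ‖riemannZeta w‖ ≤ (1 + ‖w‖) * (C * (1 + ‖w‖) ^ δ) := by gcongr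
        _ ≤ 9 * ((1 + ‖w‖) * (C * (1 + ‖w‖) ^ δ)) := by
          linarith [show 0 ≤ (1 + ‖w‖) * (C * (1 + ‖w‖) ^ δ) by positivity]
        _ = _ := by ring
    · have h7 : ‖w - 1‖⁻¹ ≤ 9 * (1 + ‖w‖)⁻¹ := by
        calc ‖w - 1‖⁻¹ ≤ ((1 + ‖w‖) / 9)⁻¹ := inv_anti₀ (by positivity) h1
          _ = _ := by field_simp
      calc ‖w - 1‖⁻¹ * ‖(riemannZeta w)⁻¹‖ ≤ (9 * (1 + ‖w‖)⁻¹) * (C * (1 + ‖w‖) ^ δ) := by gcongr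
        _ = _ := by ring
  rcases le_or_gt (5 / 4) w.re with h1 | h1
  · have h2 : 5 / 4 ≤ ‖w‖ := h1.trans (Complex.re_le_norm w)
    have h3 : ‖w‖ - 1 ≤ ‖w - 1‖ := by simpa using norm_sub_norm_le w 1
    have h4 : K ≤ C * (1 + ‖w‖) ^ δ := by
      have := Real.one_le_rpow hw1 hδ.le
      nlinarith
    exact hmain (by linarith) ((hK w h1).1.trans h4) ((hK w h1).2.trans h4)
  · rcases le_or_gt 2 |w.im| with h2 | h2
    · obtain ⟨k1, k2⟩ := hC₁ w hw (by linarith) h2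
      have h3 : |w.im| ≤ ‖w - 1‖ := by simpa using Complex.abs_im_le_norm (w - 1)
      have h4 : ‖w‖ ≤ 5 / 4 + |w.im| := by
        have := Complex.norm_le_abs_re_add_abs_im w
        rw [abs_of_pos (by linarith : 0 < w.re)] at this
        linarith
      have h5 : C₁ * |w.im| ^ δ ≤ C * (1 + ‖w‖) ^ δ := by
        have h6 : |w.im| ≤ 1 + ‖w‖ := (Complex.abs_im_le_norm w).trans (by linarith)
        gcongr
      exact hmain (by linarith) (k1.trans h5) (k2.trans h5)
    · have hmem : w ∈ Set.Icc (3 / 5 + δ') (5 / 4) ×ℂ Set.Icc (-2) 2 :=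
        ⟨⟨hw, h1.le⟩, abs_le.1 h2.le⟩
      have h4 : 1 + ‖w‖ ≤ 9 := by
        have := Complex.norm_le_abs_re_add_abs_im w
        rw [abs_of_pos (by linarith : 0 < w.re)] at this
        linarith
      constructor
      · have := Real.one_le_rpow hw1 (by linarith : 0 ≤ 1 + δ)
        have := hC₂ w hmem
        nlinarith
      · have h5 : (1 : ℝ) / 9 ≤ (1 + ‖w‖) ^ (-1 + δ) := by
          calc (1 : ℝ) / 9 ≤ (1 + ‖w‖)⁻¹ := by
                rw [one_div]; exact inv_anti₀ hw0 h4
            _ = (1 + ‖w‖) ^ (-1 : ℝ) := (Real.rpow_neg_one _).symm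
            _ ≤ _ := Real.rpow_le_rpow_of_exponent_le hw1 (by linarith)
        have := hC₃ w hmem
        nlinarith

theorem riemannZeta₁_one_sub {w : ℂ} (hw : 0 < w.re) (hw1 : w ≠ 1) :
    riemannZeta₁ (1 - w) = -w / (w - 1) * zetaFactor w * riemannZeta₁ w := by
  have hw0 : w ≠ 0 := by rintro rfl; simp at hw
  have h1 : riemannZeta₁ (1 - w) = -w * riemannZeta (1 - w) := by
    rw [riemannZeta_eq_inv_sub_mul (by simpa using hw0)]
    rw [show 1 - w - 1 = -w by ring, mul_inv_cancel_left₀ (neg_ne_zero.2 hw0)]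
  rw [h1, riemannZeta_one_sub (fun n hn => by
    rw [hn] at hw
    simp at hw
    linarith [n.cast_nonneg (α := ℝ)]) hw1, riemannZeta_eq_inv_sub_mul hw1, zetaFactor]
  ring

theorem QRH.exists_norm_riemannZeta₁_one_sub_le (h : QRH (1 / 10)) {δ δ' : ℝ} (hδ : 0 < δ)
    (hδ' : 0 < δ') (hδ'1 : δ' ≤ 1 / 2) :
    ∃ C : ℝ, 0 < C ∧ ∀ w : ℂ, 3 / 5 + δ' ≤ w.re → w.re ≤ 9 / 10 →
      ‖riemannZeta₁ (1 - w)‖ ≤ C * (1 + ‖w‖) ^ (w.re + 1 / 2 + δ) := by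
  obtain ⟨C, hC0, hC⟩ := h.exists_norm_riemannZeta₁_le_rpow hδ hδ' hδ'1
  refine ⟨11 * Real.exp 3 * C, by positivity, fun w hw1 hw2 => ?_⟩
  have hne : w ≠ 1 := by
    rintro rfl
    norm_num at hw2
  have hw0 : 0 < 1 + ‖w‖ := by positivity
  rw [riemannZeta₁_one_sub (by linarith) hne, norm_mul, norm_mul, norm_div, norm_neg]
  have h1 : 1 / 10 ≤ ‖w - 1‖ := by
    have := Complex.abs_re_le_norm (w - 1)
    rw [Complex.sub_re, Complex.one_re] at this
    linarith [neg_abs_le (w.re - 1)]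
  have h2 : ‖w‖ / ‖w - 1‖ ≤ 11 := by
    rw [div_le_iff₀ (by linarith)]
    have := norm_add_le (w - 1) 1
    rw [sub_add_cancel, norm_one] at this
    linarith
  have h3 : ‖zetaFactor w‖ ≤ Real.exp 3 * (1 + ‖w‖) ^ (w.re - 1 / 2) := by
    refine (norm_zetaFactor_le (by linarith) (by linarith)).trans ?_
    have := Complex.abs_im_le_norm w
    gcongr
    linarith
  calc _ ≤ 11 * (Real.exp 3 * (1 + ‖w‖) ^ (w.re - 1 / 2)) * (C * (1 + ‖w‖) ^ (1 + δ)) := by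
        gcongr
        exact (hC w hw1).1
    _ = 11 * Real.exp 3 * C * ((1 + ‖w‖) ^ (w.re - 1 / 2) * (1 + ‖w‖) ^ (1 + δ)) := by ring
    _ = _ := by rw [← Real.rpow_add hw0]; ring_nf

/-- The function `ζ(2s) ζ(3s) / ζ(6s)` multiplied by `(s - 1/2) (s - 1/3)`. -/
noncomputable def zetaQuot (s : ℂ) : ℂ :=
  riemannZeta₁ (2 * s) * riemannZeta₁ (3 * s) * (6 * s - 1) / (6 * riemannZeta₁ (6 * s))

theorem zetaQuot_eq {s : ℂ} (h2 : s ≠ 1 / 2) (h3 : s ≠ 1 / 3) (h6 : s ≠ 1 / 6) :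
    zetaQuot s = riemannZeta (2 * s) * riemannZeta (3 * s) / riemannZeta (6 * s) *
      ((s - 1 / 2) * (s - 1 / 3)) := by
  have e2 : 2 * s ≠ 1 := fun h => h2 (by linear_combination h / 2)
  have e3 : 3 * s ≠ 1 := fun h => h3 (by linear_combination h / 3)
  have e6 : 6 * s ≠ 1 := fun h => h6 (by linear_combination h / 6)
  rw [riemannZeta_eq_inv_sub_mul e2, riemannZeta_eq_inv_sub_mul e3, riemannZeta_eq_inv_sub_mul e6,
    zetaQuot]
  have d2 : 2 * s - 1 ≠ 0 := sub_ne_zero.2 e2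
  have d3 : 3 * s - 1 ≠ 0 := sub_ne_zero.2 e3
  have d6 : 6 * s - 1 ≠ 0 := sub_ne_zero.2 e6
  have : (s - 1 / 2) * (s - 1 / 3) = (2 * s - 1) * (3 * s - 1) / 6 := by ring
  rw [this]
  by_cases h0 : riemannZeta₁ (6 * s) = 0
  · simp [h0]
  · generalize riemannZeta₁ (6 * s) = c at h0 ⊢
    generalize riemannZeta₁ (2 * s) = a
    generalize riemannZeta₁ (3 * s) = b
    generalize 2 * s - 1 = x at d2 ⊢
    generalize 3 * s - 1 = y at d3 ⊢
    generalize 6 * s - 1 = z at d6 ⊢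
    field_simp

theorem QRH.differentiableOn_zetaQuot (h : QRH (1 / 10)) :
    DifferentiableOn ℂ zetaQuot {s | 1 / 10 < s.re} := by
  intro s hs
  have hs' : 1 / 10 < s.re := hs
  have h6 : riemannZeta₁ (6 * s) ≠ 0 := h.riemannZeta₁_ne_zero (by norm_num) (by
    have : (6 * s).re = 6 * s.re := by simp
    rw [this]; linarith)
  have hd := differentiable_riemannZeta₁
  unfold zetaQuot
  refine DifferentiableAt.differentiableWithinAt ?_
  refine DifferentiableAt.div ?_ ?_ (mul_ne_zero (by norm_num) h6)
  · fun_prop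
  · fun_prop

theorem QRH.exists_norm_zetaQuot_le_left (h : QRH (1 / 10)) {κ : ℝ} (hκ : 0 < κ)
    (hκ1 : κ ≤ 1 / 100) :
    ∃ C : ℝ, 0 < C ∧ ∀ s : ℂ, s.re = 1 / 10 + κ →
      ‖zetaQuot s‖ ≤ C * (1 + ‖s‖) ^ (5 / 2 - 2 * κ) := by
  obtain ⟨C₁, hC₁0, hC₁⟩ := h.exists_norm_riemannZeta₁_one_sub_le hκ
    (by positivity : 0 < 6 * κ) (by linarith)
  obtain ⟨C₂, hC₂0, hC₂⟩ := h.exists_norm_riemannZeta₁_le_rpow hκ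
    (by positivity : 0 < 6 * κ) (by linarith)
  refine ⟨C₁ * 3 ^ (13 / 10 - κ) * (C₁ * 3 ^ (6 / 5 - 2 * κ)) * 6 * C₂, by positivity,
    fun s hs => ?_⟩
  set P := 1 + ‖s‖ with hP
  have hP1 : 1 ≤ P := by simp [hP]
  have hP0 : 0 < P := by linarith
  have aux : ∀ (k : ℝ), 0 ≤ k → k ≤ 3 → 3 / 5 + 6 * κ ≤ 1 - k * s.re → 1 - k * s.re ≤ 9 / 10 →
      ‖riemannZeta₁ (k * s)‖ ≤ C₁ * (3 * P) ^ (1 - k * s.re + 1 / 2 + κ) := by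
    intro k hk0 hk h1 h2
    have hre : (1 - (k : ℂ) * s).re = 1 - k * s.re := by simp
    have := hC₁ (1 - k * s) (by rwa [hre]) (by rwa [hre])
    rw [sub_sub_cancel, hre] at this
    refine this.trans ?_
    gcongr
    · linarith
    have h3 := norm_sub_le 1 ((k : ℂ) * s)
    rw [norm_one, norm_mul, Complex.norm_real, Real.norm_of_nonneg hk0] at h3
    nlinarith [norm_nonneg s]
  have b2 := aux 2 (by norm_num) (by norm_num) (by rw [hs]; linarith) (by rw [hs]; linarith)
  have b3 := aux 3 (by norm_num) (by norm_num) (by rw [hs]; linarith) (by rw [hs]; linarith)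
  rw [hs, show 1 - 2 * (1 / 10 + κ) + 1 / 2 + κ = 13 / 10 - κ by ring,
    Real.mul_rpow (by norm_num) hP0.le] at b2
  rw [hs, show 1 - 3 * (1 / 10 + κ) + 1 / 2 + κ = 6 / 5 - 2 * κ by ring,
    Real.mul_rpow (by norm_num) hP0.le] at b3
  push_cast at b2 b3
  have h6 : ‖(6 * riemannZeta₁ (6 * s))⁻¹‖ ≤ C₂ * P ^ (-1 + κ) := by
    have hre : (6 * s).re = 6 * s.re := by simp
    have h7 := (hC₂ (6 * s) (by rw [hre, hs]; linarith)).2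
    rw [mul_inv, norm_mul]
    have h8 : ‖(6 : ℂ)⁻¹‖ ≤ 1 := by rw [norm_inv]; norm_num
    have h9 : (1 + ‖6 * s‖) ^ (-1 + κ) ≤ P ^ (-1 + κ) := by
      apply Real.rpow_le_rpow_of_nonpos hP0 _ (by linarith)
      rw [norm_mul]
      norm_num
      linarith [norm_nonneg s]
    calc _ ≤ 1 * (C₂ * (1 + ‖6 * s‖) ^ (-1 + κ)) := by gcongr
      _ ≤ 1 * (C₂ * P ^ (-1 + κ)) := by gcongr
      _ = _ := one_mul _
  have h7 : ‖6 * s - 1‖ ≤ 6 * P := by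
    have := norm_sub_le (6 * s) 1
    rw [norm_mul, norm_one] at this
    norm_num at this
    linarith
  rw [zetaQuot, div_eq_mul_inv, norm_mul, norm_mul, norm_mul]
  calc _ ≤ C₁ * (3 ^ (13 / 10 - κ) * P ^ (13 / 10 - κ)) *
          (C₁ * (3 ^ (6 / 5 - 2 * κ) * P ^ (6 / 5 - 2 * κ))) * (6 * P) * (C₂ * P ^ (-1 + κ)) := by
        gcongr
    _ = C₁ * 3 ^ (13 / 10 - κ) * (C₁ * 3 ^ (6 / 5 - 2 * κ)) * 6 * C₂ *
          (P ^ (13 / 10 - κ) * P ^ (6 / 5 - 2 * κ) * P ^ (1 : ℝ) * P ^ (-1 + κ)) := by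
        rw [Real.rpow_one]; ring
    _ = _ := by
        rw [← Real.rpow_add hP0, ← Real.rpow_add hP0, ← Real.rpow_add hP0]
        ring_nf

theorem QRH.exists_norm_zetaQuot_le_right (h : QRH (1 / 10)) {κ : ℝ} (hκ : 0 < κ)
    (hκ1 : κ ≤ 1 / 100) :
    ∃ C : ℝ, 0 < C ∧ ∀ s : ℂ, s.re = 2 →
      ‖zetaQuot s‖ ≤ C * (1 + ‖s‖) ^ (5 / 2 - 2 * κ) := by
  obtain ⟨C, hC0, hC⟩ := h.exists_norm_riemannZeta₁_le_rpow hκ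
    (by positivity : 0 < 6 * κ) (by linarith)
  refine ⟨C * 3 ^ (1 + κ) * (C * 3 ^ (1 + κ)) * 6 * C, by positivity, fun s hs => ?_⟩
  set P := 1 + ‖s‖ with hP
  have hP1 : 1 ≤ P := by simp [hP]
  have hP0 : 0 < P := by linarith
  have aux : ∀ (k : ℝ), 1 ≤ k → k ≤ 3 →
      ‖riemannZeta₁ (k * s)‖ ≤ C * (3 ^ (1 + κ) * P ^ (1 + κ)) := by
    intro k hk0 hk
    have hre : ((k : ℂ) * s).re = k * s.re := by simp
    refine (hC (k * s) (by rw [hre, hs]; linarith)).1.trans ?_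
    rw [← Real.mul_rpow (by norm_num) hP0.le]
    gcongr
    rw [norm_mul, Complex.norm_real, Real.norm_of_nonneg (by linarith)]
    nlinarith [norm_nonneg s]
  have b2 := aux 2 (by norm_num) (by norm_num)
  have b3 := aux 3 (by norm_num) (by norm_num)
  push_cast at b2 b3
  have h6 : ‖(6 * riemannZeta₁ (6 * s))⁻¹‖ ≤ C * P ^ (-1 + κ) := by
    have hre : (6 * s).re = 6 * s.re := by simp
    have h7 := (hC (6 * s) (by rw [hre, hs]; linarith)).2
    rw [mul_inv, norm_mul]
    have h8 : ‖(6 : ℂ)⁻¹‖ ≤ 1 := by rw [norm_inv]; norm_num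
    have h9 : (1 + ‖6 * s‖) ^ (-1 + κ) ≤ P ^ (-1 + κ) := by
      apply Real.rpow_le_rpow_of_nonpos hP0 _ (by linarith)
      rw [norm_mul]
      norm_num
      linarith [norm_nonneg s]
    calc _ ≤ 1 * (C * (1 + ‖6 * s‖) ^ (-1 + κ)) := by gcongr
      _ ≤ 1 * (C * P ^ (-1 + κ)) := by gcongr
      _ = _ := one_mul _
  have h7 : ‖6 * s - 1‖ ≤ 6 * P := by
    have := norm_sub_le (6 * s) 1
    rw [norm_mul, norm_one] at this
    norm_num at this
    linarith
  rw [zetaQuot, div_eq_mul_inv, norm_mul, norm_mul, norm_mul]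
  calc _ ≤ C * (3 ^ (1 + κ) * P ^ (1 + κ)) * (C * (3 ^ (1 + κ) * P ^ (1 + κ))) * (6 * P) *
          (C * P ^ (-1 + κ)) := by
        gcongr
    _ = C * 3 ^ (1 + κ) * (C * 3 ^ (1 + κ)) * 6 * C *
          (P ^ (1 + κ) * P ^ (1 + κ) * P ^ (1 : ℝ) * P ^ (-1 + κ)) := by
        rw [Real.rpow_one]; ring
    _ ≤ _ := by
        rw [← Real.rpow_add hP0, ← Real.rpow_add hP0, ← Real.rpow_add hP0]
        gcongr 1
        exact Real.rpow_le_rpow_of_exponent_le hP1 (by linarith)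

theorem QRH.exists_norm_zetaQuot_le_pow (h : QRH (1 / 10)) {κ : ℝ} (hκ : 0 < κ)
    (hκ1 : κ ≤ 1 / 100) :
    ∃ C : ℝ, 0 < C ∧ ∀ s : ℂ, 1 / 10 + κ ≤ s.re → ‖zetaQuot s‖ ≤ C * (1 + ‖s‖) ^ 5 := by
  obtain ⟨C, hC0, hC⟩ := h.exists_norm_riemannZeta₁_le_rpow hκ
    (by positivity : 0 < 6 * κ) (by linarith)
  refine ⟨123 * 123 * 6 * C, by positivity, fun s hs => ?_⟩
  set P := 1 + ‖s‖ with hP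
  have hP1 : 1 ≤ P := by simp [hP]
  have hP0 : 0 < P := by linarith
  have aux : ∀ (k : ℝ), 1 ≤ k → k ≤ 3 → ‖riemannZeta₁ (k * s)‖ ≤ 123 * P ^ 2 := by
    intro k hk0 hk
    have hre : ((k : ℂ) * s).re = k * s.re := by simp
    have h1 : 1 / 10 ≤ ((k : ℂ) * s).re := by rw [hre]; nlinarith
    refine (norm_riemannZeta₁_le (by linarith)).trans ?_
    have h2 : ‖(k : ℂ) * s‖ ≤ 3 * P := by
      rw [norm_mul, Complex.norm_real, Real.norm_of_nonneg (by linarith)]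
      nlinarith [norm_nonneg s]
    have h3 : 1 / ((k : ℂ) * s).re ≤ 10 := by
      rw [div_le_iff₀ (by linarith)]; linarith
    have h4 : ‖(k : ℂ) * s‖ * (‖(k : ℂ) * s‖ + 1) * (1 / ((k : ℂ) * s).re) ≤
        (3 * P) * (3 * P + P) * 10 := by
      gcongr
    nlinarith
  have b2 := aux 2 (by norm_num) (by norm_num)
  have b3 := aux 3 (by norm_num) (by norm_num)
  push_cast at b2 b3
  have h6 : ‖(6 * riemannZeta₁ (6 * s))⁻¹‖ ≤ C := by
    have hre : (6 * s).re = 6 * s.re := by simp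
    have h7 := (hC (6 * s) (by rw [hre]; linarith)).2
    rw [mul_inv, norm_mul]
    have h8 : ‖(6 : ℂ)⁻¹‖ ≤ 1 := by rw [norm_inv]; norm_num
    have h9 : (1 + ‖6 * s‖) ^ (-1 + κ) ≤ 1 :=
      Real.rpow_le_one_of_one_le_of_nonpos (by linarith [norm_nonneg (6 * s)]) (by linarith)
    calc _ ≤ 1 * (C * (1 + ‖6 * s‖) ^ (-1 + κ)) := by gcongr
      _ ≤ 1 * (C * 1) := by gcongr
      _ = _ := by ring
  have h7 : ‖6 * s - 1‖ ≤ 6 * P := by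
    have := norm_sub_le (6 * s) 1
    rw [norm_mul, norm_one] at this
    norm_num at this
    linarith
  rw [zetaQuot, div_eq_mul_inv, norm_mul, norm_mul, norm_mul]
  calc _ ≤ (123 * P ^ 2) * (123 * P ^ 2) * (6 * P) * C := by gcongr
    _ = _ := by ring

theorem QRH.exists_norm_zetaQuot_le (h : QRH (1 / 10)) {κ : ℝ} (hκ : 0 < κ)
    (hκ1 : κ ≤ 1 / 100) :
    ∃ C : ℝ, 0 < C ∧ ∀ s : ℂ, 1 / 10 + κ ≤ s.re → s.re ≤ 2 →
      ‖zetaQuot s‖ ≤ C * (1 + ‖s‖) ^ (5 / 2 - 2 * κ) := by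
  obtain ⟨C₁, hC₁0, hC₁⟩ := h.exists_norm_zetaQuot_le_left hκ hκ1
  obtain ⟨C₂, hC₂0, hC₂⟩ := h.exists_norm_zetaQuot_le_right hκ hκ1
  obtain ⟨C₃, hC₃0, hC₃⟩ := h.exists_norm_zetaQuot_le_pow hκ hκ1
  set q := 5 / 2 - 2 * κ with hq
  have hq0 : 0 < q := by rw [hq]; linarith
  have hnorm1 : ∀ s : ℂ, 0 ≤ s.re → 1 ≤ ‖s + 1‖ := fun s hs => by
    have := Complex.re_le_norm (s + 1)
    rw [Complex.add_re, Complex.one_re] at this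
    linarith
  have hcpow : ∀ s : ℂ, ‖(s + 1) ^ (q : ℂ)‖ = ‖s + 1‖ ^ q := fun s => Complex.norm_cpow_real _ _
  have hnorm2 : ∀ s : ℂ, 0 ≤ s.re → 1 + ‖s‖ ≤ 2 * ‖s + 1‖ := fun s hs => by
    have h1 := hnorm1 s hs
    have h2 : ‖s‖ ≤ ‖s + 1‖ := by
      rw [Complex.norm_def, Complex.norm_def]
      apply Real.sqrt_le_sqrt
      simp only [Complex.normSq_apply, Complex.add_re, Complex.one_re, Complex.add_im,
        Complex.one_im]
      nlinarith
    linarith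
  have hedge : ∀ s : ℂ, 0 ≤ s.re → ‖zetaQuot s‖ ≤ max C₁ C₂ * (1 + ‖s‖) ^ q →
      ‖zetaQuot s / (s + 1) ^ (q : ℂ)‖ ≤ max C₁ C₂ * 2 ^ q := fun s hs hb => by
    have h1 := hnorm1 s hs
    rw [norm_div, hcpow, div_le_iff₀ (by positivity), mul_assoc,
      ← Real.mul_rpow (by norm_num) (norm_nonneg _)]
    refine hb.trans ?_
    have := hnorm2 s hs
    gcongr
  have hd : DifferentiableOn ℂ (fun s => zetaQuot s / (s + 1) ^ (q : ℂ)) {s | 1 / 10 < s.re} := by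
    refine h.differentiableOn_zetaQuot.div ?_ ?_
    · intro s hs
      have hs' : 1 / 10 < s.re := hs
      refine DifferentiableAt.differentiableWithinAt ?_
      refine DifferentiableAt.cpow (by fun_prop) (by fun_prop) (Or.inl ?_)
      simp; linarith
    · intro s hs h0
      have hs' : 1 / 10 < s.re := hs
      have := hcpow s
      rw [h0, norm_zero] at this
      have h1 := hnorm1 s (by linarith)
      have : 0 < ‖s + 1‖ ^ q := by positivity
      linarith
  have hcl : closure (Complex.re ⁻¹' Set.Ioo (1 / 10 + κ) 2) ⊆ {s : ℂ | 1 / 10 < s.re} := by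
    refine (closure_minimal (t := Complex.re ⁻¹' Set.Icc (1 / 10 + κ) 2)
      (Set.preimage_mono Set.Ioo_subset_Icc_self)
      (isClosed_Icc.preimage Complex.continuous_re)).trans ?_
    intro s hs
    have : 1 / 10 + κ ≤ s.re := hs.1
    show 1 / 10 < s.re
    linarith
  have key : ∀ s : ℂ, 1 / 10 + κ ≤ s.re → s.re ≤ 2 →
      ‖zetaQuot s / (s + 1) ^ (q : ℂ)‖ ≤ max C₁ C₂ * 2 ^ q := by
    intro s hs1 hs2
    refine PhragmenLindelof.vertical_strip (f := fun s => zetaQuot s / (s + 1) ^ (q : ℂ))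
      (a := 1 / 10 + κ) (b := 2)
      (hd.mono hcl).diffContOnCl ?_ ?_ ?_ hs1 hs2
    · refine ⟨1, ?_, 5, ?_⟩
      · rw [lt_div_iff₀ (by linarith)]
        linarith [Real.pi_gt_three]
      · refine Asymptotics.IsBigO.of_bound (C₃ * 3 ^ 5) ?_
        refine Filter.eventually_inf_principal.2 (Filter.Eventually.of_forall fun z hz => ?_)
        have hz1 : 1 / 10 + κ < z.re := hz.1
        have hz2 : z.re < 2 := hz.2
        have h1 := hnorm1 z (by linarith)
        have h2 : 1 + ‖z‖ ≤ 3 * Real.exp |z.im| := by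
          have h3 := Complex.norm_le_abs_re_add_abs_im z
          rw [abs_of_pos (by linarith : 0 < z.re)] at h3
          have h4 := Real.add_one_le_exp |z.im|
          linarith [abs_nonneg z.im]
        have h3 : (1 : ℝ) ≤ ‖z + 1‖ ^ q := Real.one_le_rpow h1 hq0.le
        rw [norm_div, hcpow, Real.norm_of_nonneg (Real.exp_pos _).le]
        calc ‖zetaQuot z‖ / ‖z + 1‖ ^ q ≤ ‖zetaQuot z‖ := div_le_self (norm_nonneg _) h3
          _ ≤ C₃ * (1 + ‖z‖) ^ 5 := hC₃ z hz1.le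
          _ ≤ C₃ * (3 * Real.exp |z.im|) ^ 5 := by gcongr
          _ = C₃ * 3 ^ 5 * Real.exp (5 * |z.im|) := by
              rw [mul_pow, ← Real.exp_nat_mul]; push_cast; ring
          _ ≤ _ := by
              gcongr
              rw [one_mul]
              linarith [Real.add_one_le_exp |z.im|]
    · intro z hz
      refine hedge z (by rw [hz]; linarith) ((hC₁ z hz).trans ?_)
      gcongr
      exact le_max_left _ _
    · intro z hz
      refine hedge z (by rw [hz]; norm_num) ((hC₂ z hz).trans ?_)
      gcongr
      exact le_max_right _ _
  refine ⟨max C₁ C₂ * 2 ^ q, by positivity, fun s hs1 hs2 => ?_⟩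
  have h1 := key s hs1 hs2
  have h2 := hnorm1 s (by linarith)
  rw [norm_div, hcpow, div_le_iff₀ (by positivity)] at h1
  refine h1.trans ?_
  have h3 := norm_add_le s 1
  rw [norm_one] at h3
  gcongr
  linarith

theorem zetaQuot_one_half :
    zetaQuot (1 / 2) * 2 = riemannZeta (3 / 2) / riemannZeta 3 / 6 := by
  have h3 : riemannZeta₁ 3 ≠ 0 := fun h0 => by
    have h := riemannZeta_ne_zero_of_one_lt_re (s := 3) (by norm_num)
    rw [riemannZeta_eq_inv_sub_mul (by norm_num), h0, mul_zero] at h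
    exact h rfl
  rw [zetaQuot, riemannZeta_eq_inv_sub_mul (s := 3 / 2) (by norm_num),
    riemannZeta_eq_inv_sub_mul (s := 3) (by norm_num),
    show (2 : ℂ) * (1 / 2) = 1 by norm_num, show (3 : ℂ) * (1 / 2) = 3 / 2 by norm_num,
    show (6 : ℂ) * (1 / 2) = 3 by norm_num, riemannZeta₁_one]
  field_simp
  norm_num

theorem zetaQuot_one_third :
    zetaQuot (1 / 3) * 3 = -(riemannZeta (2 / 3) / riemannZeta 2 / 6) := by
  have h3 : riemannZeta₁ 2 ≠ 0 := fun h0 => by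
    have h := riemannZeta_ne_zero_of_one_lt_re (s := 2) (by norm_num)
    rw [riemannZeta_eq_inv_sub_mul (by norm_num), h0, mul_zero] at h
    exact h rfl
  rw [zetaQuot, riemannZeta_eq_inv_sub_mul (s := 2 / 3) (by norm_num),
    riemannZeta_eq_inv_sub_mul (s := 2) (by norm_num),
    show (2 : ℂ) * (1 / 3) = 2 / 3 by norm_num, show (3 : ℂ) * (1 / 3) = 1 by norm_num,
    show (6 : ℂ) * (1 / 3) = 2 by norm_num, riemannZeta₁_one,
    show (2 / 3 - 1 : ℂ) = -(1 / 3) by norm_num, show (2 - 1 : ℂ) = 1 by norm_num]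
  field_simp

theorem dslope_dslope_eq {M : ℂ → ℂ} {a b s : ℂ} (hab : b ≠ a) (ha : M a = 0) (hb : M b = 0)
    (hsa : s ≠ a) (hsb : s ≠ b) : dslope (dslope M a) b s = M s / ((s - a) * (s - b)) := by
  rw [dslope_of_ne _ hsb, slope_def_field, dslope_of_ne _ hsa, dslope_of_ne _ hab, slope_def_field,
    slope_def_field, ha, hb]
  have := sub_ne_zero.2 hsa
  have := sub_ne_zero.2 hsb
  field_simp
  simp

theorem QRH.exists_continuation (h : QRH (1 / 10)) {κ : ℝ} (hκ : 0 < κ) (hκ1 : κ ≤ 1 / 100) :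
    ∃ (G : ℂ → ℂ) (C : ℝ), DifferentiableOn ℂ G {s | 1 / 10 + κ < s.re ∧ s.re < 2} ∧
      (∀ s : ℂ, 1 / 10 + κ < s.re → s.re < 2 → ‖G s‖ ≤ C * (1 + |s.im|) ^ (-(1 / 2 + 2 * κ))) ∧
      ∀ s : ℂ, 1 / 2 < s.re → G s = riemannZeta (2 * s) * riemannZeta (3 * s) /
        riemannZeta (6 * s) / s - riemannZeta (3 / 2) / riemannZeta 3 / (s - 1 / 2) -
        riemannZeta (2 / 3) / riemannZeta 2 / (s - 1 / 3) := by
  obtain ⟨C, hC0, hC⟩ := h.exists_norm_zetaQuot_le hκ hκ1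
  set c₁ := riemannZeta (3 / 2) / riemannZeta 3 with hc₁
  set c₂ := riemannZeta (2 / 3) / riemannZeta 2 with hc₂
  set M : ℂ → ℂ := fun s => zetaQuot s / s - c₁ * (s - 1 / 3) - c₂ * (s - 1 / 2) with hM
  have hMa : M (1 / 2) = 0 := by
    have := zetaQuot_one_half
    simp only [hM]
    linear_combination this
  have hMb : M (1 / 3) = 0 := by
    have := zetaQuot_one_third
    simp only [hM]
    linear_combination this
  have hab : (1 / 3 : ℂ) ≠ 1 / 2 := by norm_num
  have hopen : IsOpen {s : ℂ | 1 / 10 < s.re} := isOpen_lt continuous_const Complex.continuous_re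
  have hMd : DifferentiableOn ℂ M {s | 1 / 10 < s.re} := by
    refine ((h.differentiableOn_zetaQuot.div differentiableOn_id ?_).sub ?_).sub ?_
    · intro s hs h0
      have hs' : 1 / 10 < s.re := hs
      rw [id] at h0
      rw [h0] at hs'
      norm_num at hs'
    · exact (by fun_prop : Differentiable ℂ fun s => c₁ * (s - 1 / 3)).differentiableOn
    · exact (by fun_prop : Differentiable ℂ fun s => c₂ * (s - 1 / 2)).differentiableOn
  have hGd : DifferentiableOn ℂ (dslope (dslope M (1 / 2)) (1 / 3)) {s | 1 / 10 < s.re} := by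
    refine (Complex.differentiableOn_dslope (hopen.mem_nhds ?_)).2
      ((Complex.differentiableOn_dslope (hopen.mem_nhds ?_)).2 hMd)
    · norm_num
    · norm_num
  have hcpt : IsCompact (Set.Icc (1 / 10 + κ) 2 ×ℂ Set.Icc (-2) 2) :=
    isCompact_Icc.reProdIm isCompact_Icc
  obtain ⟨C', hC'⟩ := hcpt.exists_bound_of_continuousOn (hGd.continuousOn.mono fun s hs => by
    have : 1 / 10 + κ ≤ s.re := hs.1.1
    show 1 / 10 < s.re
    linarith)
  set p := 1 / 2 + 2 * κ with hp
  have hp0 : 0 < p := by positivity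
  set A := (C * 3 ^ (5 / 2 - 2 * κ) + ‖c₁‖ * 3 + ‖c₂‖ * 3) * (3 / 2) * 9 with hA
  have hA0 : 0 ≤ A := by positivity
  refine ⟨dslope (dslope M (1 / 2)) (1 / 3), A + |C'| * 3 ^ p, hGd.mono fun s hs => ?_,
    fun s hs1 hs2 => ?_, fun s hs => ?_⟩
  · have : 1 / 10 + κ < s.re := hs.1
    show 1 / 10 < s.re
    linarith
  · set T := |s.im| with hT
    have hT0 : 0 ≤ T := abs_nonneg _
    have hT1 : 0 < 1 + T := by positivity
    rcases le_or_gt T 2 with h1 | h1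
    · have h2 := hC' s ⟨⟨hs1.le, hs2.le⟩, abs_le.1 h1⟩
      have h3 : (3 : ℝ) ^ (-p) ≤ (1 + T) ^ (-p) :=
        Real.rpow_le_rpow_of_nonpos hT1 (by linarith) (by linarith)
      calc _ ≤ |C'| := h2.trans (le_abs_self _)
        _ = |C'| * 3 ^ p * 3 ^ (-p) := by
          rw [mul_assoc, ← Real.rpow_add (by norm_num), add_neg_cancel, Real.rpow_zero, mul_one]
        _ ≤ |C'| * 3 ^ p * (1 + T) ^ (-p) := by gcongr
        _ ≤ _ := by
          gcongr
          linarith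
    · have hreal : ∀ x : ℝ, T ≤ ‖s - x‖ := fun x => by
        have := Complex.abs_im_le_norm (s - x)
        rwa [Complex.sub_im, Complex.ofReal_im, sub_zero] at this
      have h2 : T ≤ ‖s - 1 / 2‖ := by
        have := hreal (1 / 2)
        push_cast at this
        exact this
      have h3 : T ≤ ‖s - 1 / 3‖ := by
        have := hreal (1 / 3)
        push_cast at this
        exact this
      have h0 : T ≤ ‖s‖ := Complex.abs_im_le_norm s
      have hne2 : s ≠ 1 / 2 := fun h => by
        rw [h, sub_self, norm_zero] at h2
        linarith
      have hne3 : s ≠ 1 / 3 := fun h => by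
        rw [h, sub_self, norm_zero] at h3
        linarith
      rw [dslope_dslope_eq hab hMa hMb hne2 hne3, norm_div, norm_mul]
      have hsn : 1 + ‖s‖ ≤ 3 * (1 + T) := by
        have h3 := Complex.norm_le_abs_re_add_abs_im s
        rw [abs_of_pos (by linarith : 0 < s.re)] at h3
        linarith
      have hn3 : ‖(1 / 3 : ℂ)‖ ≤ 1 := by norm_num
      have hn2 : ‖(1 / 2 : ℂ)‖ ≤ 1 := by norm_num
      have hTT : (1 + T) * (2 / 3) ≤ T := by linarith
      have hTT' : (1 + T) * (1 / 3) ≤ T := by linarith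
      have hM : ‖M s‖ ≤ (C * 3 ^ (5 / 2 - 2 * κ) + ‖c₁‖ * 3 + ‖c₂‖ * 3) * (3 / 2) *
          (1 + T) ^ (3 / 2 - 2 * κ) := by
        have e1 : ‖zetaQuot s / s‖ ≤
            C * 3 ^ (5 / 2 - 2 * κ) * (3 / 2) * (1 + T) ^ (3 / 2 - 2 * κ) := by
          rw [norm_div, div_le_iff₀ (by linarith)]
          calc ‖zetaQuot s‖ ≤ C * (1 + ‖s‖) ^ (5 / 2 - 2 * κ) := hC s hs1.le hs2.le
            _ ≤ C * (3 * (1 + T)) ^ (5 / 2 - 2 * κ) := by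
              gcongr
              linarith
            _ = C * 3 ^ (5 / 2 - 2 * κ) * (3 / 2) * (1 + T) ^ (3 / 2 - 2 * κ) *
                ((1 + T) * (2 / 3)) := by
              rw [Real.mul_rpow (by norm_num) hT1.le, show 5 / 2 - 2 * κ = 3 / 2 - 2 * κ + 1 by ring,
                Real.rpow_add_one hT1.ne']
              ring
            _ ≤ _ := by
              gcongr
              linarith
        have e0 : 1 + T ≤ (1 + T) ^ (3 / 2 - 2 * κ) := by
          have := Real.rpow_le_rpow_of_exponent_le (by linarith : 1 ≤ 1 + T)
            (by linarith : 1 ≤ 3 / 2 - 2 * κ)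
          rwa [Real.rpow_one] at this
        have e2 : ‖c₁ * (s - 1 / 3)‖ ≤ ‖c₁‖ * 3 * (3 / 2) * (1 + T) ^ (3 / 2 - 2 * κ) := by
          rw [norm_mul]
          have := norm_sub_le s (1 / 3)
          have h5 : ‖s - 1 / 3‖ ≤ 3 * (3 / 2) * (1 + T) ^ (3 / 2 - 2 * κ) := by linarith
          calc _ ≤ ‖c₁‖ * (3 * (3 / 2) * (1 + T) ^ (3 / 2 - 2 * κ)) := by gcongr
            _ = _ := by ring
        have e3 : ‖c₂ * (s - 1 / 2)‖ ≤ ‖c₂‖ * 3 * (3 / 2) * (1 + T) ^ (3 / 2 - 2 * κ) := by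
          rw [norm_mul]
          have := norm_sub_le s (1 / 2)
          have h5 : ‖s - 1 / 2‖ ≤ 3 * (3 / 2) * (1 + T) ^ (3 / 2 - 2 * κ) := by linarith
          calc _ ≤ ‖c₂‖ * (3 * (3 / 2) * (1 + T) ^ (3 / 2 - 2 * κ)) := by gcongr
            _ = _ := by ring
        calc ‖M s‖ ≤ ‖zetaQuot s / s‖ + ‖c₁ * (s - 1 / 3)‖ + ‖c₂ * (s - 1 / 2)‖ :=
              (norm_sub_le _ _).trans (by gcongr; exact norm_sub_le _ _)
          _ ≤ _ := by linarith
      have hden : (1 + T) * (1 / 3) * ((1 + T) * (1 / 3)) ≤ ‖s - 1 / 2‖ * ‖s - 1 / 3‖ := by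
        gcongr <;> linarith
      calc _ ≤ ((C * 3 ^ (5 / 2 - 2 * κ) + ‖c₁‖ * 3 + ‖c₂‖ * 3) * (3 / 2) *
            (1 + T) ^ (3 / 2 - 2 * κ)) / ((1 + T) * (1 / 3) * ((1 + T) * (1 / 3))) := by
            gcongr
        _ = A * (1 + T) ^ (-p) := by
            rw [show 3 / 2 - 2 * κ = -p + 2 by rw [hp]; ring, Real.rpow_add hT1, hA,
              Real.rpow_two]
            field_simp
            norm_num
        _ ≤ _ := by
          gcongr
          linarith [show 0 ≤ |C'| * 3 ^ p by positivity]
  · have hne : ∀ x : ℝ, x ≤ 1 / 2 → s ≠ x := fun x hx h => by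
      rw [h, Complex.ofReal_re] at hs
      linarith
    have h2 : s ≠ 1 / 2 := by simpa using hne (1 / 2) le_rfl
    have h3 : s ≠ 1 / 3 := by simpa using hne (1 / 3) (by norm_num)
    have h6 : s ≠ 1 / 6 := by simpa using hne (1 / 6) (by norm_num)
    have h0 : s ≠ 0 := by simpa using hne 0 (by norm_num)
    rw [dslope_dslope_eq hab hMa hMb h2 h3]
    simp only [hM]
    rw [zetaQuot_eq h2 h3 h6]
    have h2' := sub_ne_zero.2 h2
    have h3' := sub_ne_zero.2 h3
    generalize riemannZeta (2 * s) * riemannZeta (3 * s) / riemannZeta (6 * s) = F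
    generalize s - 1 / 2 = x at h2' ⊢
    generalize s - 1 / 3 = y at h3' ⊢
    field_simp

theorem isSquarefull_mul_iff {m n : ℕ} (h : Nat.Coprime m n) :
    IsSquarefull (m * n) ↔ IsSquarefull m ∧ IsSquarefull n := by
  constructor
  · intro hmn
    constructor
    · intro p hp hpm
      have hc : Nat.Coprime (p ^ 2) n := (h.coprime_dvd_left hpm).pow_left 2
      exact hc.dvd_of_dvd_mul_right (hmn p hp (hpm.mul_right n))
    · intro p hp hpn
      have hc : Nat.Coprime (p ^ 2) m := (h.symm.coprime_dvd_left hpn).pow_left 2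
      exact hc.dvd_of_dvd_mul_left (hmn p hp (hpn.mul_left m))
  · rintro ⟨hm, hn⟩ p hp hpmn
    rcases (hp.dvd_mul).1 hpmn with h1 | h1
    · exact (hm p hp h1).mul_right n
    · exact (hn p hp h1).mul_left m

theorem sqf_mul {m n : ℕ} (h : Nat.Coprime m n) : sqf (m * n) = sqf m * sqf n := by
  unfold sqf
  rw [isSquarefull_mul_iff h]
  by_cases h1 : IsSquarefull m <;> by_cases h2 : IsSquarefull n <;> simp [h1, h2]

theorem isSquarefull_prime_pow_iff {p : ℕ} (hp : p.Prime) {e : ℕ} :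
    IsSquarefull (p ^ e) ↔ e ≠ 1 := by
  constructor
  · rintro h rfl
    have := h p hp (by simp)
    rw [Nat.pow_dvd_pow_iff_le_right hp.one_lt] at this
    omega
  · intro he q hq hqp
    have h1 : q = p := (Nat.prime_dvd_prime_iff_eq hq hp).1 (hq.dvd_of_dvd_pow hqp)
    subst h1
    rcases Nat.eq_zero_or_pos e with rfl | h0
    · rw [pow_zero] at hqp
      exact absurd (Nat.dvd_one.1 hqp) hq.one_lt.ne'
    · exact pow_dvd_pow q (by omega)

theorem sqf_one : sqf 1 = 1 := by
  refine if_pos fun p hp h => ?_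
  exact absurd (Nat.dvd_one.1 h) hp.one_lt.ne'

theorem sqf_nonneg (n : ℕ) : 0 ≤ sqf n := by
  unfold sqf
  split_ifs <;> norm_num

theorem IsSquarefull.exists_eq_sq_mul_cube {n : ℕ} (hn : IsSquarefull n) :
    ∃ a b : ℕ, a ^ 2 * b ^ 3 = n := by
  obtain ⟨a, b, hab, ha⟩ := Nat.sq_mul_squarefree n
  have hdvd : a ∣ b := by
    rw [← Nat.prod_primeFactors_of_squarefree ha]
    refine Finset.prod_primes_dvd _ (fun p hp => (Nat.prime_of_mem_primeFactors hp).prime)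
      fun p hp => ?_
    have hp' := Nat.prime_of_mem_primeFactors hp
    have hpa := Nat.dvd_of_mem_primeFactors hp
    by_contra hpb
    have h1 : p ^ 2 ∣ n := hn p hp' (by rw [← hab]; exact hpa.mul_left _)
    rw [← hab] at h1
    have h2 : Nat.Coprime (p ^ 2) (b ^ 2) := ((Nat.Prime.coprime_iff_not_dvd hp').2 hpb).pow 2 2
    have h3 := h2.dvd_of_dvd_mul_left h1
    rw [sq] at h3
    exact hp'.one_lt.ne' (Nat.isUnit_iff.1 (ha p h3))
  obtain ⟨c, rfl⟩ := hdvd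
  exact ⟨c, a, by rw [← hab]; ring⟩

theorem summable_sqf_mul_rpow {σ : ℝ} (hσ : 1 / 2 < σ) :
    Summable fun n : ℕ => sqf n * (n : ℝ) ^ (-σ) := by
  have h1 : Summable fun q : ℕ × ℕ => (q.1 : ℝ) ^ (-(2 * σ)) * (q.2 : ℝ) ^ (-(3 * σ)) := by
    refine Summable.mul_of_nonneg (f := fun a : ℕ => (a : ℝ) ^ (-(2 * σ)))
      (g := fun b : ℕ => (b : ℝ) ^ (-(3 * σ))) (Real.summable_nat_rpow.2 (by linarith))
      (Real.summable_nat_rpow.2 (by linarith)) (fun a => ?_) (fun a => ?_)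
    · simp only [Pi.zero_apply]; positivity
    · simp only [Pi.zero_apply]; positivity
  choose a b hab using fun n : {n : ℕ | IsSquarefull n} => n.2.exists_eq_sq_mul_cube
  have hinj : Function.Injective fun n => (a n, b n) := by
    intro m n hmn
    simp only [Prod.mk.injEq] at hmn
    apply Subtype.ext
    rw [← hab m, ← hab n, hmn.1, hmn.2]
  have h2 := h1.comp_injective hinj
  have h3 : (fun n : ℕ => sqf n * (n : ℝ) ^ (-σ)) =
      {n : ℕ | IsSquarefull n}.indicator fun n : ℕ => (n : ℝ) ^ (-σ) := by
    ext n
    by_cases hn : IsSquarefull n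
    · rw [Set.indicator_of_mem (show n ∈ {n : ℕ | IsSquarefull n} from hn), sqf, if_pos hn, one_mul]
    · rw [Set.indicator_of_notMem (show n ∉ {n : ℕ | IsSquarefull n} from hn), sqf, if_neg hn,
        zero_mul]
  rw [h3, ← summable_subtype_iff_indicator]
  refine h2.congr fun n => ?_
  simp only [Function.comp]
  have h4 : ((n : ℕ) : ℝ) = (a n : ℝ) ^ 2 * (b n : ℝ) ^ 3 := by
    rw [← hab n]; push_cast; ring
  rw [h4, Real.mul_rpow (by positivity) (by positivity), ← Real.rpow_natCast, ← Real.rpow_natCast,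
    ← Real.rpow_mul (by positivity), ← Real.rpow_mul (by positivity)]
  push_cast
  ring_nf

theorem exists_sum_sqf_le : ∃ C : ℝ, 0 < C ∧ ∀ N : ℕ,
    ∑ n ∈ Finset.Icc 1 N, sqf n ≤ C * (N : ℝ) ^ (3 / 5 : ℝ) := by
  have hs := summable_sqf_mul_rpow (σ := 3 / 5) (by norm_num)
  have hnn : ∀ n : ℕ, 0 ≤ sqf n * (n : ℝ) ^ (-(3 / 5) : ℝ) := fun n =>
    mul_nonneg (sqf_nonneg n) (by positivity)
  refine ⟨(∑' n : ℕ, sqf n * (n : ℝ) ^ (-(3 / 5) : ℝ)) + 1, ?_, fun N => ?_⟩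
  · have h0 : 0 ≤ ∑' n : ℕ, sqf n * (n : ℝ) ^ (-(3 / 5) : ℝ) := tsum_nonneg hnn
    linarith
  · calc ∑ n ∈ Finset.Icc 1 N, sqf n
        ≤ ∑ n ∈ Finset.Icc 1 N, sqf n * (n : ℝ) ^ (-(3 / 5) : ℝ) * (N : ℝ) ^ (3 / 5 : ℝ) := by
          refine Finset.sum_le_sum fun n hn => ?_
          rw [Finset.mem_Icc] at hn
          have hn0 : (0 : ℝ) < n := by exact_mod_cast hn.1
          have h1 : (n : ℝ) ^ (3 / 5 : ℝ) ≤ (N : ℝ) ^ (3 / 5 : ℝ) := by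
            have : (n : ℝ) ≤ N := by exact_mod_cast hn.2
            gcongr
          have h2 : (n : ℝ) ^ (-(3 / 5) : ℝ) * (n : ℝ) ^ (3 / 5 : ℝ) = 1 := by
            rw [← Real.rpow_add hn0]; norm_num
          have h3 : (1 : ℝ) ≤ (n : ℝ) ^ (-(3 / 5) : ℝ) * (N : ℝ) ^ (3 / 5 : ℝ) := by
            rw [← h2]; gcongr
          nlinarith [sqf_nonneg n]
      _ = (∑ n ∈ Finset.Icc 1 N, sqf n * (n : ℝ) ^ (-(3 / 5) : ℝ)) * (N : ℝ) ^ (3 / 5 : ℝ) := by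
          rw [Finset.sum_mul]
      _ ≤ _ := by
          gcongr
          have := hs.sum_le_tsum (Finset.Icc 1 N) fun n _ => hnn n
          linarith

theorem LSeries_sqf_eq {s : ℂ} (hs : 1 / 2 < s.re) :
    LSeries (fun n => (sqf n : ℂ)) s =
      riemannZeta (2 * s) * riemannZeta (3 * s) / riemannZeta (6 * s) := by
  set f : ℕ → ℂ := LSeries.term (fun n => (sqf n : ℂ)) s with hf
  have hs0 : s ≠ 0 := by
    rintro rfl
    norm_num at hs
  have hfn : ∀ n, f n = if n = 0 then 0 else (sqf n : ℂ) / (n : ℂ) ^ s := fun n => by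
    rw [hf, LSeries.term_def]
  have hf0 : f 0 = 0 := by rw [hfn]; simp
  have hf1 : f 1 = 1 := by rw [hfn]; simp [sqf_one]
  have hmul : ∀ {m n : ℕ}, Nat.Coprime m n → f (m * n) = f m * f n := by
    intro m n hmn
    rw [hfn, hfn, hfn]
    rcases eq_or_ne m 0 with rfl | hm
    · simp
    rcases eq_or_ne n 0 with rfl | hn
    · simp
    rw [if_neg hm, if_neg hn, if_neg (mul_ne_zero hm hn), sqf_mul hmn]
    push_cast
    rw [Complex.natCast_mul_natCast_cpow]
    ring
  have hsum : Summable fun n => ‖f n‖ := by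
    refine (summable_sqf_mul_rpow hs).of_nonneg_of_le (fun n => norm_nonneg _) fun n => ?_
    rw [hfn]
    split_ifs with h0
    · rw [norm_zero]
      exact mul_nonneg (sqf_nonneg n) (by positivity)
    · rw [norm_div, Complex.norm_natCast_cpow_of_pos (Nat.pos_of_ne_zero h0), Complex.norm_real,
        Real.norm_of_nonneg (sqf_nonneg n), Real.rpow_neg (by positivity), div_eq_mul_inv]
  have hL : LSeries (fun n => (sqf n : ℂ)) s = ∑' n, f n := rfl
  have hprod := EulerProduct.eulerProduct_hasProd hf1 hmul hsum hf0
  rw [← hL] at hprod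
  have r2 : (2 * s).re = 2 * s.re := by simp
  have r3 : (3 * s).re = 3 * s.re := by simp
  have r6 : (6 * s).re = 6 * s.re := by simp
  have h2 := riemannZeta_eulerProduct_hasProd (s := 2 * s) (by rw [r2]; linarith)
  have h3 := riemannZeta_eulerProduct_hasProd (s := 3 * s) (by rw [r3]; linarith)
  have h6 := riemannZeta_eulerProduct_hasProd (s := 6 * s) (by rw [r6]; linarith)
  have hne : riemannZeta (6 * s) ≠ 0 :=
    riemannZeta_ne_zero_of_one_lt_re (by rw [r6]; linarith)
  rw [eq_div_iff hne]
  refine (hprod.mul h6).unique ?_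
  convert! h2.mul h3 using 2 with p
  have hp := p.2
  set x : ℂ := (p : ℂ) ^ (-s) with hx
  have hx1 : ‖x‖ < 1 := by
    rw [hx, Complex.norm_natCast_cpow_of_pos hp.pos, Complex.neg_re]
    exact Real.rpow_lt_one_of_one_lt_of_neg (by exact_mod_cast hp.one_lt) (by linarith)
  have hpow : ∀ k : ℕ, (p : ℂ) ^ (-((k : ℂ) * s)) = x ^ k := fun k => by
    rw [hx, ← Complex.cpow_nat_mul]
    ring_nf
  have e2 := hpow 2
  have e3 := hpow 3
  have e6 := hpow 6
  push_cast at e2 e3 e6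
  rw [e2, e3, e6]
  have hloc : ∑' e, f ((p : ℕ) ^ e) = (1 - x)⁻¹ - x := by
    have h1 := (hasSum_geometric_of_norm_lt_one hx1).sub (hasSum_ite_eq 1 x)
    rw [← h1.tsum_eq]
    refine tsum_congr fun e => ?_
    rw [hfn, if_neg (pow_ne_zero e hp.ne_zero), sqf, isSquarefull_prime_pow_iff hp]
    rcases eq_or_ne e 1 with rfl | he
    · simp
    · rw [if_pos he, if_neg he, sub_zero, hx, Complex.cpow_neg, inv_pow, ← Complex.cpow_nat_mul]
      push_cast
      rw [← Complex.natCast_cpow_natCast_mul, one_div]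
  rw [hloc]
  have hnk : ∀ k : ℕ, k ≠ 0 → 1 - x ^ k ≠ 0 := fun k hk h0 => by
    have h1 : x ^ k = 1 := (sub_eq_zero.1 h0).symm
    have h2 : ‖x‖ ^ k < 1 := pow_lt_one₀ (norm_nonneg _) hx1 hk
    rw [← norm_pow, h1, norm_one] at h2
    exact lt_irrefl _ h2
  have n1 := hnk 1 one_ne_zero
  rw [pow_one] at n1
  have n2 := hnk 2 two_ne_zero
  have n3 := hnk 3 three_ne_zero
  have n6 := hnk 6 (by norm_num)
  rw [← mul_inv, inv_eq_one_div (_ * _), eq_div_iff (mul_ne_zero n2 n3)]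
  field_simp
  ring

theorem ofReal_zr (x : ℝ) : (zr x : ℂ) = riemannZeta x := by
  have h := riemannZeta_conj (x : ℂ)
  rw [Complex.conj_ofReal] at h
  exact Complex.conj_eq_iff_re.1 h.symm

/-- The error term in the counting function of square-full numbers. -/
noncomputable def sqfError (x : ℝ) : ℝ :=
  ∑ n ∈ Finset.Icc 1 ⌊x⌋₊, sqf n -
    (zr (3 / 2) / zr 3 * x ^ (1 / 2 : ℝ) + zr (2 / 3) / zr 2 * x ^ (1 / 3 : ℝ))

theorem measurable_sum_sqf : Measurable fun x : ℝ => ∑ n ∈ Finset.Icc 1 ⌊x⌋₊, sqf n :=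
  (measurable_from_nat (f := fun N : ℕ => ∑ n ∈ Finset.Icc 1 N, sqf n)).comp Nat.measurable_floor

theorem measurable_sqfError : Measurable sqfError := by
  unfold sqfError
  have := measurable_sum_sqf
  fun_prop

theorem exists_abs_sqfError_le :
    ∃ C : ℝ, ∀ x : ℝ, 1 ≤ x → |sqfError x| ≤ C * x ^ (3 / 5 : ℝ) := by
  obtain ⟨C, hC0, hC⟩ := exists_sum_sqf_le
  refine ⟨C + |zr (3 / 2) / zr 3| + |zr (2 / 3) / zr 2|, fun x hx => ?_⟩
  have hx0 : 0 ≤ x := by linarith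
  have h1 : |∑ n ∈ Finset.Icc 1 ⌊x⌋₊, sqf n| ≤ C * x ^ (3 / 5 : ℝ) := by
    rw [abs_of_nonneg (Finset.sum_nonneg fun n _ => sqf_nonneg n)]
    refine (hC _).trans ?_
    have := Nat.floor_le hx0
    gcongr
  have h2 : ∀ r : ℝ, r ≤ 3 / 5 → |x ^ r| ≤ x ^ (3 / 5 : ℝ) := fun r hr => by
    rw [abs_of_nonneg (by positivity)]
    exact Real.rpow_le_rpow_of_exponent_le hx hr
  unfold sqfError
  calc _ ≤ |∑ n ∈ Finset.Icc 1 ⌊x⌋₊, sqf n| + (|zr (3 / 2) / zr 3| * |x ^ (1 / 2 : ℝ)| +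
        |zr (2 / 3) / zr 2| * |x ^ (1 / 3 : ℝ)|) := by
        rw [← abs_mul, ← abs_mul]
        exact (abs_sub _ _).trans (by gcongr; exact abs_add_le _ _)
    _ ≤ C * x ^ (3 / 5 : ℝ) + (|zr (3 / 2) / zr 3| * x ^ (3 / 5 : ℝ) +
        |zr (2 / 3) / zr 2| * x ^ (3 / 5 : ℝ)) := by
        gcongr
        · exact h2 _ (by norm_num)
        · exact h2 _ (by norm_num)
    _ = _ := by ring

theorem image_exp_Ioi_zero : Real.exp '' Set.Ioi 0 = Set.Ioi 1 := by
  ext x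
  simp only [Set.mem_image, Set.mem_Ioi]
  constructor
  · rintro ⟨u, hu, rfl⟩
    exact Real.one_lt_exp_iff.2 hu
  · intro hx
    exact ⟨Real.log x, Real.log_pos hx, Real.exp_log (by linarith)⟩

theorem integral_Ioi_one_eq {E : Type*} [NormedAddCommGroup E] [NormedSpace ℝ E] (g : ℝ → E) :
    ∫ x in Set.Ioi (1 : ℝ), g x = ∫ u in Set.Ioi (0 : ℝ), Real.exp u • g (Real.exp u) := by
  rw [← image_exp_Ioi_zero, integral_image_eq_integral_abs_deriv_smul measurableSet_Ioi
    (fun u _ => (Real.hasDerivAt_exp u).hasDerivWithinAt) Real.exp_injective.injOn]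
  simp only [Real.abs_exp]

theorem integrableOn_Ioi_one_iff {E : Type*} [NormedAddCommGroup E] [NormedSpace ℝ E] (g : ℝ → E) :
    IntegrableOn g (Set.Ioi 1) ↔
      IntegrableOn (fun u => Real.exp u • g (Real.exp u)) (Set.Ioi 0) := by
  rw [← image_exp_Ioi_zero, integrableOn_image_iff_integrableOn_abs_deriv_smul measurableSet_Ioi
    (fun u _ => (Real.hasDerivAt_exp u).hasDerivWithinAt) Real.exp_injective.injOn]
  simp only [Real.abs_exp]

theorem integral_sum_sqf_mul_exp {s : ℂ} (hs : 3 / 5 < s.re) :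
    IntegrableOn (fun u : ℝ => ((∑ n ∈ Finset.Icc 1 ⌊Real.exp u⌋₊, sqf n : ℝ) : ℂ) *
      Complex.exp (-(s * u))) (Set.Ioi 0) ∧
    ∫ u in Set.Ioi (0 : ℝ), ((∑ n ∈ Finset.Icc 1 ⌊Real.exp u⌋₊, sqf n : ℝ) : ℂ) *
      Complex.exp (-(s * u)) =
      riemannZeta (2 * s) * riemannZeta (3 * s) / riemannZeta (6 * s) / s := by
  obtain ⟨C, hC0, hC⟩ := exists_sum_sqf_le
  have hs0 : s ≠ 0 := by
    rintro rfl
    norm_num at hs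
  constructor
  · refine Integrable.mono' (g := fun u => C * Real.exp ((3 / 5 - s.re) * u))
      ((integrableOn_exp_mul_Ioi (by linarith) 0).const_mul C) ?_ ?_
    · refine Measurable.aestronglyMeasurable ?_
      have := measurable_sum_sqf.comp Real.measurable_exp
      simp only [Function.comp_def] at this
      fun_prop
    · refine (ae_restrict_iff' measurableSet_Ioi).2 (Filter.Eventually.of_forall fun u hu => ?_)
      rw [norm_mul, Complex.norm_real, Real.norm_of_nonneg
        (Finset.sum_nonneg fun n _ => sqf_nonneg n), Complex.norm_exp]
      have h1 : (-(s * u)).re = -s.re * u := by simp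
      have h2 : Real.exp ((3 / 5 - s.re) * u) = (Real.exp u) ^ (3 / 5 : ℝ) *
          Real.exp (-s.re * u) := by
        rw [← Real.exp_mul, ← Real.exp_add]; ring_nf
      rw [h1, h2, ← mul_assoc]
      gcongr
      refine (hC _).trans ?_
      have := Nat.floor_le (Real.exp_pos u).le
      gcongr
  · have hO : (fun n : ℕ => ∑ k ∈ Finset.Icc 1 n, sqf k) =O[Filter.atTop]
        fun n => (n : ℝ) ^ (3 / 5 : ℝ) := by
      refine Asymptotics.IsBigO.of_bound C (Filter.Eventually.of_forall fun n => ?_)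
      rw [Real.norm_of_nonneg (Finset.sum_nonneg fun n _ => sqf_nonneg n),
        Real.norm_of_nonneg (by positivity)]
      exact hC n
    have h1 := LSeries_eq_mul_integral_of_nonneg sqf (by norm_num) hs hO sqf_nonneg
    rw [LSeries_sqf_eq (by linarith), integral_Ioi_one_eq] at h1
    rw [h1, mul_div_cancel_left₀ _ hs0]
    refine setIntegral_congr_fun measurableSet_Ioi fun u _ => ?_
    have h3 : ((Real.exp u : ℝ) : ℂ) ^ (-(s + 1)) =
        Complex.exp (-(s * u)) * ((Real.exp u : ℝ) : ℂ)⁻¹ := by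
      rw [Complex.cpow_def_of_ne_zero (by exact_mod_cast (Real.exp_pos u).ne'),
        ← Complex.ofReal_log (Real.exp_pos u).le, Real.log_exp, Complex.ofReal_exp,
        ← Complex.exp_neg, ← Complex.exp_add]
      ring_nf
    have h4 : ((Real.exp u : ℝ) : ℂ) ≠ 0 := by exact_mod_cast (Real.exp_pos u).ne'
    simp only [Complex.real_smul]
    rw [h3]
    push_cast at h4 ⊢
    field_simp

theorem integral_rpow_exp_mul_exp {r : ℝ} {s : ℂ} (hs : r < s.re) :
    IntegrableOn (fun u : ℝ => (((Real.exp u) ^ r : ℝ) : ℂ) * Complex.exp (-(s * u))) (Set.Ioi 0) ∧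
    ∫ u in Set.Ioi (0 : ℝ), (((Real.exp u) ^ r : ℝ) : ℂ) * Complex.exp (-(s * u)) =
      1 / (s - r) := by
  have h1 : (fun u : ℝ => (((Real.exp u) ^ r : ℝ) : ℂ) * Complex.exp (-(s * u))) =
      fun u : ℝ => Complex.exp ((r - s) * u) := by
    ext u
    rw [← Real.exp_mul, Complex.ofReal_exp, ← Complex.exp_add]
    push_cast
    ring_nf
  have hre : ((r : ℂ) - s).re < 0 := by simpa using hs
  rw [h1]
  refine ⟨integrableOn_exp_mul_complex_Ioi hre 0, ?_⟩
  rw [integral_exp_mul_complex_Ioi hre 0, Complex.ofReal_zero, mul_zero, Complex.exp_zero,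
    ← neg_sub s r, neg_div_neg_eq]

theorem integral_sqfError_mul_exp {s : ℂ} (hs : 3 / 5 < s.re) :
    ∫ u in Set.Ioi (0 : ℝ), (sqfError (Real.exp u) : ℂ) * Complex.exp (-(s * u)) =
      riemannZeta (2 * s) * riemannZeta (3 * s) / riemannZeta (6 * s) / s -
        riemannZeta (3 / 2) / riemannZeta 3 / (s - 1 / 2) -
        riemannZeta (2 / 3) / riemannZeta 2 / (s - 1 / 3) := by
  obtain ⟨i1, e1⟩ := integral_sum_sqf_mul_exp hs
  obtain ⟨i2, e2⟩ := integral_rpow_exp_mul_exp (r := 1 / 2) (s := s) (by linarith)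
  obtain ⟨i3, e3⟩ := integral_rpow_exp_mul_exp (r := 1 / 3) (s := s) (by linarith)
  have h1 := ofReal_zr (3 / 2)
  have h2 := ofReal_zr 3
  have h3 := ofReal_zr (2 / 3)
  have h4 := ofReal_zr 2
  push_cast at h1 h2 h3 h4
  have hfun : (fun u : ℝ => (sqfError (Real.exp u) : ℂ) * Complex.exp (-(s * u))) = fun u : ℝ =>
      ((∑ n ∈ Finset.Icc 1 ⌊Real.exp u⌋₊, sqf n : ℝ) : ℂ) * Complex.exp (-(s * u)) -
      riemannZeta (3 / 2) / riemannZeta 3 *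
        ((((Real.exp u) ^ (1 / 2 : ℝ) : ℝ) : ℂ) * Complex.exp (-(s * u))) -
      riemannZeta (2 / 3) / riemannZeta 2 *
        ((((Real.exp u) ^ (1 / 3 : ℝ) : ℝ) : ℂ) * Complex.exp (-(s * u))) := by
    ext u
    rw [sqfError, ← h1, ← h2, ← h3, ← h4]
    simp only [Complex.ofReal_sub, Complex.ofReal_add, Complex.ofReal_mul, Complex.ofReal_div]
    ring
  have i12 : IntegrableOn (fun u : ℝ => ((∑ n ∈ Finset.Icc 1 ⌊Real.exp u⌋₊, sqf n : ℝ) : ℂ) *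
      Complex.exp (-(s * u)) - riemannZeta (3 / 2) / riemannZeta 3 *
        ((((Real.exp u) ^ (1 / 2 : ℝ) : ℝ) : ℂ) * Complex.exp (-(s * u)))) (Set.Ioi 0) :=
    i1.sub (i2.const_mul _)
  rw [hfun, integral_sub i12 (i3.const_mul _),
    integral_sub i1 (i2.const_mul _), integral_const_mul, integral_const_mul, e1, e2, e3]
  push_cast
  ring

theorem QRH.integrableOn_sq_sqfError (h : QRH (1 / 10)) {ε : ℝ} (hε : 0 < ε)
    (hε1 : ε < 1 / 1000) :
    IntegrableOn (fun x => sqfError x ^ 2 * x ^ (-(1 / 5 + 5 * ε + 1))) (Set.Ioi 1) := by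
  obtain ⟨G, C, hG, hGb, hGe⟩ := h.exists_continuation (κ := 2 * ε) (by linarith) (by linarith)
  obtain ⟨A, hA⟩ := exists_abs_sqfError_le
  set f : ℝ → ℝ := (Set.Ici (0 : ℝ)).indicator fun u => sqfError (Real.exp u) with hf
  have hfm : Measurable f := (measurable_sqfError.comp Real.measurable_exp).indicator
    measurableSet_Ici
  have hf0 : ∀ u < 0, f u = 0 := fun u hu => Set.indicator_of_notMem (by simpa using hu) _
  have hf1 : ∀ u, 0 ≤ u → f u = sqfError (Real.exp u) := fun u hu =>
    Set.indicator_of_mem (by simpa using hu) _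
  have hfA : ∀ u, 0 ≤ u → |f u| ≤ A * Real.exp (3 / 5 * u) := fun u hu => by
    rw [hf1 u hu, mul_comm (3 / 5 : ℝ), Real.exp_mul]
    exact hA _ (Real.one_le_exp hu)
  have key := integrable_sq_mul_exp_of_laplace hfm hf0 hfA hG (p := 1 / 2 + 2 * (2 * ε))
    (by linarith) (C := C) (fun s hs1 hs2 => hGb s hs1 hs2)
    (fun s hs1 hs2 => by
      rw [hGe s (by linarith), ← integral_sqfError_mul_exp hs1, ← integral_Ici_eq_integral_Ioi,
        ← integral_indicator measurableSet_Ici]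
      refine integral_congr_ae (Filter.Eventually.of_forall fun u => ?_)
      simp only [hf]
      by_cases hu : u ∈ Set.Ici (0 : ℝ)
      · rw [Set.indicator_of_mem hu, Set.indicator_of_mem hu]
      · rw [Set.indicator_of_notMem hu, Set.indicator_of_notMem hu, Complex.ofReal_zero, zero_mul])
    (by linarith) (by linarith) (σ := 1 / 10 + 5 / 2 * ε) (by linarith) (by linarith)
  rw [integrableOn_Ioi_one_iff]
  refine key.integrableOn.congr_fun (fun u hu => ?_) measurableSet_Ioi
  have hu' : 0 < u := hu
  simp only [smul_eq_mul]
  rw [hf1 u hu'.le, ← Real.exp_mul]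
  rw [mul_left_comm, ← Real.exp_add]
  ring_nf

theorem sum_Ioc_sqf_sub_eq {x H : ℝ} (hH : 0 ≤ H) :
    (∑ n ∈ Finset.Ioc ⌊x⌋₊ ⌊x + H⌋₊, sqf n) -
      ((zr (3/2) / zr 3) * Dd (1/2) x H + (zr (2/3) / zr 2) * Dd (1/3) x H) =
      sqfError (x + H) - sqfError x := by
  have h1 : ⌊x⌋₊ ≤ ⌊x + H⌋₊ := Nat.floor_mono (by linarith)
  have h2 : ∑ n ∈ Finset.Icc 1 ⌊x + H⌋₊, sqf n =
      ∑ n ∈ Finset.Icc 1 ⌊x⌋₊, sqf n + ∑ n ∈ Finset.Ioc ⌊x⌋₊ ⌊x + H⌋₊, sqf n := by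
    have e : ∀ N : ℕ, Finset.Icc 1 N = Finset.Ioc 0 N := fun N => by
      ext n; simp [Nat.succ_le_iff]
    rw [e, e, Finset.sum_Ioc_consecutive _ (Nat.zero_le _) h1]
  rw [sqfError, sqfError, h2, Dd, Dd]
  ring

theorem stmt0 (hQRH : QRH (1/10)) (ε : ℝ) (hε : ε ∈ Set.Ioo (0:ℝ) (1/1000)) :
    ∃ C : ℝ, 0 < C ∧ ∀ X H : ℝ, 2 ≤ X → X ^ ε ≤ H → H ≤ X ^ (1 - ε) →
      (1 / X) * (∫ x in X..(2*X),
        |(∑ n ∈ Finset.Ioc ⌊x⌋₊ ⌊x + H⌋₊, sqf n) -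
          ((zr (3/2) / zr 3) * Dd (1/2) x H + (zr (2/3) / zr 2) * Dd (1/3) x H)| ^ 2)
      ≤ C * X ^ (1/5 + 5 * ε) := by
  obtain ⟨hε0, hε1⟩ := hε
  have hInteg := hQRH.integrableOn_sq_sqfError hε0 hε1
  set τ := 1 / 5 + 5 * ε with hτ
  set J := ∫ x in Set.Ioi (1 : ℝ), sqfError x ^ 2 * x ^ (-(τ + 1)) with hJ
  have hJ0 : 0 ≤ J := setIntegral_nonneg measurableSet_Ioi fun x hx => by
    have : (1 : ℝ) < x := hx
    positivity
  refine ⟨4 * 3 ^ (τ + 1) * J + 1, by positivity, fun X H hX hH1 hH2 => ?_⟩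
  have hX0 : 0 < X := by linarith
  have hH0 : 0 ≤ H := le_trans (by positivity) hH1
  have hHX : H ≤ X := by
    refine hH2.trans ?_
    have := Real.rpow_le_rpow_of_exponent_le (by linarith : 1 ≤ X) (by linarith : 1 - ε ≤ 1)
    rwa [Real.rpow_one] at this
  have hpt : ∀ x ∈ Set.Ioc X (3 * X),
      sqfError x ^ 2 ≤ (3 * X) ^ (τ + 1) * (sqfError x ^ 2 * x ^ (-(τ + 1))) := fun x hx => by
    have hx0 : 0 < x := hX0.trans hx.1
    have h1 : x ^ (τ + 1) ≤ (3 * X) ^ (τ + 1) := by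
      have := hx.2
      gcongr
    have h2 : x ^ (τ + 1) * x ^ (-(τ + 1)) = 1 := by
      rw [← Real.rpow_add hx0, add_neg_cancel, Real.rpow_zero]
    calc sqfError x ^ 2 = x ^ (τ + 1) * (sqfError x ^ 2 * x ^ (-(τ + 1))) := by
          rw [mul_left_comm, h2, mul_one]
      _ ≤ _ := by gcongr
  have hsub : Set.Ioc X (3 * X) ⊆ Set.Ioi 1 := fun x hx => by
    have := hx.1
    show 1 < x
    linarith
  have hintX : IntegrableOn (fun x => sqfError x ^ 2) (Set.Ioc X (3 * X)) := by
    refine Integrable.mono' ((hInteg.mono_set hsub).const_mul ((3 * X) ^ (τ + 1)))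
      (measurable_sqfError.pow_const 2).aestronglyMeasurable ?_
    refine (ae_restrict_iff' measurableSet_Ioc).2 (Filter.Eventually.of_forall fun x hx => ?_)
    rw [Real.norm_of_nonneg (sq_nonneg _)]
    exact hpt x hx
  have hbX : ∫ x in Set.Ioc X (3 * X), sqfError x ^ 2 ≤ (3 * X) ^ (τ + 1) * J := by
    calc _ ≤ ∫ x in Set.Ioc X (3 * X),
          (3 * X) ^ (τ + 1) * (sqfError x ^ 2 * x ^ (-(τ + 1))) :=
          setIntegral_mono_on hintX ((hInteg.mono_set hsub).const_mul _) measurableSet_Ioc hpt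
      _ = (3 * X) ^ (τ + 1) * ∫ x in Set.Ioc X (3 * X), sqfError x ^ 2 * x ^ (-(τ + 1)) :=
          integral_const_mul _ _
      _ ≤ _ := by
          gcongr
          refine setIntegral_mono_set hInteg ?_ hsub.eventuallyLE
          refine (ae_restrict_iff' measurableSet_Ioi).2 (Filter.Eventually.of_forall fun x hx => ?_)
          have : (1 : ℝ) < x := hx
          simp only [Pi.zero_apply]
          positivity
  have hpart : ∀ y : ℝ, 0 ≤ y → y ≤ X →
      IntervalIntegrable (fun x => sqfError (x + y) ^ 2) volume X (2 * X) ∧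
      ∫ x in X..(2 * X), sqfError (x + y) ^ 2 ≤ (3 * X) ^ (τ + 1) * J := fun y hy0 hyX => by
    have hss : Set.Ioc (X + y) (2 * X + y) ⊆ Set.Ioc X (3 * X) :=
      Set.Ioc_subset_Ioc (by linarith) (by linarith)
    have hle : X + y ≤ 2 * X + y := by linarith
    constructor
    · have h1 : IntervalIntegrable (fun x => sqfError x ^ 2) volume (X + y) (2 * X + y) :=
        (intervalIntegrable_iff_integrableOn_Ioc_of_le hle).2 (hintX.mono_set hss)
      simpa using h1.comp_add_right y
    · rw [intervalIntegral.integral_comp_add_right (fun x => sqfError x ^ 2) y,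
        intervalIntegral.integral_of_le hle]
      refine le_trans (setIntegral_mono_set hintX ?_ hss.eventuallyLE) hbX
      exact Filter.Eventually.of_forall fun x => sq_nonneg _
  obtain ⟨i1, b1⟩ := hpart H hH0 hHX
  obtain ⟨i2, b2⟩ := hpart 0 le_rfl hX0.le
  simp only [add_zero] at i2 b2
  have hmain : ∫ x in X..(2*X), |(∑ n ∈ Finset.Ioc ⌊x⌋₊ ⌊x + H⌋₊, sqf n) -
      ((zr (3/2) / zr 3) * Dd (1/2) x H + (zr (2/3) / zr 2) * Dd (1/3) x H)| ^ 2 ≤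
      ∫ x in X..(2*X), (2 * sqfError (x + H) ^ 2 + 2 * sqfError x ^ 2) := by
    rw [intervalIntegral.integral_of_le (by linarith), intervalIntegral.integral_of_le (by linarith)]
    refine integral_mono_of_nonneg (Filter.Eventually.of_forall fun x => sq_nonneg _)
      (((intervalIntegrable_iff_integrableOn_Ioc_of_le (by linarith)).1
        ((i1.const_mul 2).add (i2.const_mul 2)))) (Filter.Eventually.of_forall fun x => ?_)
    simp only [sum_Ioc_sqf_sub_eq hH0, sq_abs]
    nlinarith [sq_nonneg (sqfError (x + H) + sqfError x)]
  rw [intervalIntegral.integral_add (i1.const_mul 2) (i2.const_mul 2),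
    intervalIntegral.integral_const_mul, intervalIntegral.integral_const_mul] at hmain
  rw [one_div, inv_mul_le_iff₀ hX0]
  have hpow : (3 * X) ^ (τ + 1) = 3 ^ (τ + 1) * (X * X ^ τ) := by
    rw [Real.mul_rpow (by norm_num) hX0.le, Real.rpow_add_one hX0.ne', mul_comm X]
  have hpos : 0 ≤ X * X ^ τ := by positivity
  calc _ ≤ 4 * ((3 * X) ^ (τ + 1) * J) := by linarith
    _ = X * (4 * 3 ^ (τ + 1) * J * X ^ τ) := by rw [hpow]; ring
    _ ≤ _ := by
        gcongr
        linarith
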